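/- Let (u, p) be a C^∞ solution of the stationary incompressible Navier–Stokes equations on ℝ³. Let 0 < γ < 3 ≤ p < +∞ be such that η(γ,p) = γ/p − 3/p + 2/3 = 0. Assume u belongs to M^p_γ(ℝ³) and that u belongs to the homogeneous Besov space Ḃ^{−1}_{∞,∞}(ℝ³), i.e. sup_{t>0} t^{1/2} sup_{x∈ℝ³} |(h_t * u)(x)| < +∞ where h_t(x) = (4πt)^{−3/2} exp(−|x|²/(4t)) and the convolution is taken componentwise. Then u ≡ 0 and p is a constant function. -/

import Mathlib

open MeasureTheory Filter Metric Real

noncomputable section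

/-- Three-dimensional Euclidean space. -/
abbrev E3 : Type := EuclideanSpace ℝ (Fin 3)

/-- Partial derivative `∂_j f` of a scalar field. -/
def pd (j : Fin 3) (f : E3 → ℝ) (x : E3) : ℝ :=
  fderiv ℝ f x (EuclideanSpace.single j 1)

/-- Laplacian of a scalar field. -/
def lap (f : E3 → ℝ) (x : E3) : ℝ := ∑ j, pd j (pd j f) x

/-- The annulus `C(R/2, R)`. -/
def ann (R : ℝ) : Set E3 := {x : E3 | R / 2 < ‖x‖ ∧ ‖x‖ < R}

/-- Euclidean length `|u(x)|` of a vector field. -/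
def vecNorm (u : E3 → Fin 3 → ℝ) (x : E3) : ℝ := Real.sqrt (∑ i, (u x i) ^ 2)

/-- The stationary incompressible Navier–Stokes equations:
`−Δu + (u·∇)u + ∇p = 0`, `div u = 0`. -/
def StatNS (u : E3 → Fin 3 → ℝ) (P : E3 → ℝ) : Prop :=
  (∀ x : E3, ∀ i : Fin 3,
    -(lap (fun y => u y i) x) + (∑ j, u x j * pd j (fun y => u y i) x)
      + pd i P x = 0) ∧
  (∀ x : E3, ∑ j, pd j (fun y => u y j) x = 0)

/-- Membership in the local Morrey space `M^p_γ(ℝ³)`. -/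
def MemMorrey (p γ : ℝ) (f : E3 → ℝ) : Prop :=
  LocallyIntegrable (fun x => |f x| ^ p) volume ∧
  ∃ C : ℝ, ∀ R : ℝ, 1 ≤ R → R ^ (-γ) * ∫ x in ball (0 : E3) R, |f x| ^ p ≤ C

/-- Membership in `M^p_{γ,0}(ℝ³)`. -/
def MemMorrey0 (p γ : ℝ) (f : E3 → ℝ) : Prop :=
  MemMorrey p γ f ∧
  Tendsto (fun R : ℝ => R ^ (-γ) * ∫ x in ann R, |f x| ^ p) atTop (nhds 0)

/-- The heat kernel on `ℝ³`. -/
def heatKernel (t : ℝ) (x : E3) : ℝ :=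
  (4 * Real.pi * t) ^ (-(3 : ℝ) / 2) * Real.exp (-‖x‖ ^ 2 / (4 * t))

section PartialDerivatives

theorem contDiff_pd {f : E3 → ℝ} (hf : ContDiff ℝ (⊤ : ℕ∞) f) (j : Fin 3) :
    ContDiff ℝ (⊤ : ℕ∞) (pd j f) :=
  (hf.fderiv_right (m := (⊤ : ℕ∞)) (by exact_mod_cast le_top)).clm_apply contDiff_const

theorem pd_comm {f : E3 → ℝ} (hf : ContDiff ℝ (⊤ : ℕ∞) f) (j k : Fin 3) (x : E3) :
    pd j (pd k f) x = pd k (pd j f) x := by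
  have hd : DifferentiableAt ℝ (fderiv ℝ f) x :=
    ((hf.fderiv_right (m := (⊤ : ℕ∞)) (by exact_mod_cast le_top)).differentiable (by simp)) x
  have key : ∀ a b : Fin 3, pd a (pd b f) x
      = fderiv ℝ (fderiv ℝ f) x (EuclideanSpace.single a 1) (EuclideanSpace.single b 1) := by
    intro a b
    have h := hd.hasFDerivAt.clm_apply (hasFDerivAt_const (EuclideanSpace.single b (1 : ℝ)) x)
    have h' : pd a (pd b f) x = _ := congrArg (fun L => L (EuclideanSpace.single a (1 : ℝ))) h.fderiv
    rw [h']; simp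
  rw [key, key]
  exact (hf.contDiffAt.isSymmSndFDerivAt (by simpa using WithTop.coe_le_coe.2 (le_top : (2 : ℕ∞) ≤ ⊤))).eq _ _

theorem ContDiff.differentiableAt_of_top {f : E3 → ℝ} (hf : ContDiff ℝ (⊤ : ℕ∞) f) (x : E3) :
    DifferentiableAt ℝ f x := (hf.differentiable (by simp)) x

theorem pd_add {f g : E3 → ℝ} {x : E3} (hf : DifferentiableAt ℝ f x) (hg : DifferentiableAt ℝ g x)
    (j : Fin 3) : pd j (fun y => f y + g y) x = pd j f x + pd j g x := by
  simp only [pd]; rw [fderiv_fun_add hf hg]; rfl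

theorem pd_sub {f g : E3 → ℝ} {x : E3} (hf : DifferentiableAt ℝ f x) (hg : DifferentiableAt ℝ g x)
    (j : Fin 3) : pd j (fun y => f y - g y) x = pd j f x - pd j g x := by
  simp only [pd]; rw [fderiv_fun_sub hf hg]; rfl

theorem pd_mul {f g : E3 → ℝ} {x : E3} (hf : DifferentiableAt ℝ f x) (hg : DifferentiableAt ℝ g x)
    (j : Fin 3) : pd j (fun y => f y * g y) x = pd j f x * g x + f x * pd j g x := by
  simp only [pd]; rw [fderiv_fun_mul hf hg]
  simp only [add_apply, smul_apply, smul_eq_mul]; ring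

theorem pd_const_mul {g : E3 → ℝ} {x : E3} (c : ℝ) (hg : DifferentiableAt ℝ g x)
    (j : Fin 3) : pd j (fun y => c * g y) x = c * pd j g x := by
  simp only [pd]; rw [fderiv_const_mul hg]; rfl

theorem pd_sum {ι : Type*} {s : Finset ι} {f : ι → E3 → ℝ} {x : E3}
    (hf : ∀ i ∈ s, DifferentiableAt ℝ (f i) x) (j : Fin 3) :
    pd j (fun y => ∑ i ∈ s, f i y) x = ∑ i ∈ s, pd j (f i) x := by
  simp only [pd]; rw [fderiv_fun_sum hf]; simp

theorem tsupport_pd_subset (f : E3 → ℝ) (j : Fin 3) : tsupport (pd j f) ⊆ tsupport f :=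
  tsupport_fderiv_apply_subset ℝ _

theorem HasCompactSupport.pd {f : E3 → ℝ} (hf : HasCompactSupport f) (j : Fin 3) :
    HasCompactSupport (pd j f) := hf.fderiv_apply ℝ _

theorem integral_mul_pd {f g : E3 → ℝ} (hf : ContDiff ℝ (⊤ : ℕ∞) f) (hg : ContDiff ℝ (⊤ : ℕ∞) g)
    (hgc : HasCompactSupport g) (j : Fin 3) :
    ∫ x, f x * pd j g x = -∫ x, pd j f x * g x := by
  have hgc' := hgc.pd j
  refine integral_mul_fderiv_eq_neg_fderiv_mul_of_integrable ?_ ?_ ?_ ?_ ?_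
  · exact ((contDiff_pd hf j).continuous.mul hg.continuous).integrable_of_hasCompactSupport
      hgc.mul_left
  · exact (hf.continuous.mul (contDiff_pd hg j).continuous).integrable_of_hasCompactSupport
      hgc'.mul_left
  · exact (hf.continuous.mul hg.continuous).integrable_of_hasCompactSupport hgc.mul_left
  · exact fun x _ => hf.differentiableAt_of_top x
  · exact fun x _ => hg.differentiableAt_of_top x

end PartialDerivatives

section Resolvent

open scoped SchwartzMap FourierTransform LineDeriv Laplacian

theorem hasTemperateGrowth_resolvent_symbol {lam : ℝ} (hlam : 0 < lam) :
    (fun ξ : E3 => (lam + (2 * π) ^ 2 * ‖ξ‖ ^ 2)⁻¹).HasTemperateGrowth := by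
  set c : ℝ := 2 * π / √lam with hc
  have h1 := (Function.hasTemperateGrowth_one_add_norm_sq_rpow E3 (-1)).comp
    (ContinuousLinearMap.hasTemperateGrowth (c • ContinuousLinearMap.id ℝ E3))
  have h2 := (Function.HasTemperateGrowth.const (E := E3) (lam⁻¹)).mul h1
  have heq : (fun ξ : E3 => (lam + (2 * π) ^ 2 * ‖ξ‖ ^ 2)⁻¹)
      = fun ξ : E3 => lam⁻¹ * (1 + ‖c • ξ‖ ^ 2) ^ (-1 : ℝ) := by
    funext ξ
    have hs : √lam ^ 2 = lam := Real.sq_sqrt hlam.le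
    have hs0 : √lam ≠ 0 := (Real.sqrt_pos.2 hlam).ne'
    rw [Real.rpow_neg_one, norm_smul, mul_pow ‖c‖, Real.norm_eq_abs, sq_abs, ← mul_inv, hc, div_pow, hs]
    congr 1
    field_simp
  rw [heq]
  exact h2

theorem exists_resolvent_complex {lam : ℝ} (hlam : 0 < lam) (g : 𝓢(E3, ℂ)) :
    ∃ V : 𝓢(E3, ℂ), lam • V - Δ V = g := by
  have hm := hasTemperateGrowth_resolvent_symbol hlam
  set m : E3 → ℝ := fun ξ : E3 => (lam + (2 * π) ^ 2 * ‖ξ‖ ^ 2)⁻¹ with hm_def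
  have hn : (fun ξ : E3 => ‖ξ‖ ^ 2).HasTemperateGrowth := by fun_prop
  refine ⟨SchwartzMap.fourierMultiplierCLM ℂ m g, ?_⟩
  rw [SchwartzMap.laplacian_eq_fourierMultiplierCLM]
  have hn' : ((‖·‖ ^ 2 : E3 → ℝ)).HasTemperateGrowth := hn
  rw [SchwartzMap.fourierMultiplierCLM_fourierMultiplierCLM_apply hn' hm]
  simp only [SchwartzMap.fourierMultiplierCLM_apply]
  have key : lam • SchwartzMap.smulLeftCLM ℂ m (𝓕 g)
      + (2 * π) ^ 2 • SchwartzMap.smulLeftCLM ℂ ((‖·‖ ^ 2 : E3 → ℝ) * m) (𝓕 g) = 𝓕 g := by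
    ext ξ
    have h1 := SchwartzMap.smulLeftCLM_apply_apply hm (𝓕 g) ξ
    have h2 := SchwartzMap.smulLeftCLM_apply_apply (hn'.mul hm) (𝓕 g) ξ
    have hpos : lam + (2 * π) ^ 2 * ‖ξ‖ ^ 2 ≠ 0 := by positivity
    rw [add_apply, smul_apply, smul_apply, h1, h2, smul_smul, smul_smul,
      ← add_smul]
    have : lam * m ξ + (2 * π) ^ 2 * ((‖·‖ ^ 2 : E3 → ℝ) * m) ξ = 1 := by
      simp only [hm_def, Pi.mul_apply]
      field_simp
    rw [this, one_smul]
  have h3 := congrArg (fun f : 𝓢(E3, ℂ) => 𝓕⁻ f) key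
  simp only [FourierTransform.fourierInv_fourier_eq] at h3
  rw [FourierTransform.fourierInv_add, FourierTransform.fourierInv_smul,
    FourierTransform.fourierInv_smul] at h3
  rw [neg_smul, sub_neg_eq_add, h3]

theorem SchwartzMap.pd_eq_lineDerivOp (j : Fin 3) (f : 𝓢(E3, ℝ)) :
    pd j f = ⇑(∂_{(EuclideanSpace.single j 1 : E3)} f : 𝓢(E3, ℝ)) := by
  funext x
  rw [SchwartzMap.lineDerivOp_apply_eq_fderiv]; rfl

theorem exists_resolvent {lam : ℝ} (hlam : 0 < lam) (g : 𝓢(E3, ℝ)) :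
    ∃ V : 𝓢(E3, ℝ), ∀ x, lam * V x - lap V x = g x := by
  obtain ⟨W, hW⟩ := exists_resolvent_complex hlam
    (SchwartzMap.postcompCLM (𝕜 := ℝ) Complex.ofRealCLM g)
  refine ⟨SchwartzMap.postcompCLM (𝕜 := ℝ) Complex.reCLM W, fun x => ?_⟩
  have hre : ∀ (f : 𝓢(E3, ℂ)) (v : E3), ∂_{v} (SchwartzMap.postcompCLM (𝕜 := ℝ) Complex.reCLM f)
      = SchwartzMap.postcompCLM (𝕜 := ℝ) Complex.reCLM (∂_{v} f) := by
    intro f v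
    ext y
    rw [SchwartzMap.postcompCLM_apply, SchwartzMap.lineDerivOp_apply_eq_fderiv,
      SchwartzMap.lineDerivOp_apply_eq_fderiv]
    have h := Complex.reCLM.hasFDerivAt.comp y (f.hasFDerivAt y)
    have h' : HasFDerivAt (⇑(SchwartzMap.postcompCLM (𝕜 := ℝ) Complex.reCLM f))
        (Complex.reCLM.comp (fderiv ℝ f y)) y := h
    rw [h'.fderiv]; rfl
  have hlap : lap (SchwartzMap.postcompCLM (𝕜 := ℝ) Complex.reCLM W) x = (Δ W x).re := by
    unfold lap
    rw [SchwartzMap.laplacian_eq_sum (EuclideanSpace.basisFun (Fin 3) ℝ) W]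
    simp only [SchwartzMap.pd_eq_lineDerivOp, hre, SchwartzMap.postcompCLM_apply]
    simp [EuclideanSpace.basisFun_apply]
  rw [hlap, SchwartzMap.postcompCLM_apply]
  have h := congrArg (fun f : 𝓢(E3, ℂ) => (f x).re) hW
  simpa using h

theorem SchwartzMap.integral_mul_pd (f g : 𝓢(E3, ℝ)) (j : Fin 3) :
    ∫ x, f x * pd j g x = -∫ x, pd j f x * g x := by
  simp only [SchwartzMap.pd_eq_lineDerivOp]
  exact SchwartzMap.integral_mul_lineDerivOp_right_eq_neg_left f g _

theorem SchwartzMap.integrable_mul (f g : 𝓢(E3, ℝ)) : Integrable (fun x => f x * g x) := by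
  have := (SchwartzMap.smulLeftCLM ℝ (f : E3 → ℝ) g).integrable (μ := volume)
  refine this.congr (ae_of_all _ fun x => ?_)
  rw [SchwartzMap.smulLeftCLM_apply_apply f.hasTemperateGrowth]; rfl

theorem resolvent_energy {lam : ℝ} {V g : 𝓢(E3, ℝ)} (h : ∀ x, lam * V x - lap V x = g x) :
    lam ^ 2 * (∫ x, V x ^ 2) + 2 * lam * (∑ j, ∫ x, pd j V x ^ 2)
      + ∑ j, ∑ k, ∫ x, pd k (pd j V) x ^ 2 = ∫ x, g x ^ 2 := by
  set D : Fin 3 → 𝓢(E3, ℝ) := fun j => ∂_{(EuclideanSpace.single j 1 : E3)} V with hD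
  set D2 : Fin 3 → Fin 3 → 𝓢(E3, ℝ) := fun j k => ∂_{(EuclideanSpace.single k 1 : E3)} (D j) with hD2
  have e1 : ∀ j, pd j V = D j := fun j => SchwartzMap.pd_eq_lineDerivOp j V
  have e2 : ∀ j k, pd k (D j) = D2 j k := fun j k => SchwartzMap.pd_eq_lineDerivOp k (D j)
  have hlap : ∀ x, lap V x = ∑ j, D2 j j x := by
    intro x; simp only [lap, e1, e2]
  have i1 : ∀ j, ∫ x, V x * D2 j j x = -∫ x, D j x ^ 2 := by
    intro j
    have := SchwartzMap.integral_mul_pd V (D j) j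
    simp only [e1, e2] at this
    simpa only [pow_two] using this
  have i2 : ∀ j k, ∫ x, D2 j j x * D2 k k x = ∫ x, D2 j k x ^ 2 := by
    intro j k
    have a := SchwartzMap.integral_mul_pd (D2 j j) (D k) k
    have b := SchwartzMap.integral_mul_pd (D2 j k) (D k) j
    have c : ∀ x, pd k (D2 j j) x = pd j (D2 j k) x := by
      intro x
      have := pd_comm ((D j).smooth _) k j x
      rwa [e2, e2] at this
    have d : D2 k j = D2 j k := by
      ext x
      have := pd_comm (V.smooth _) j k x
      rwa [e1, e1, e2, e2] at this
    simp only [e2, c, d] at a b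
    rw [a, ← b]
    simp only [pow_two]
  simp only [e1, e2, ← h, hlap]
  have expand : ∀ x, (lam * V x - ∑ j, D2 j j x) ^ 2
      = lam ^ 2 * (V x * V x) - 2 * lam * ∑ j, V x * D2 j j x
        + ∑ j, ∑ k, D2 j j x * D2 k k x := by
    intro x
    rw [← Finset.mul_sum, ← Finset.sum_mul_sum]; ring
  simp only [expand]
  have I := SchwartzMap.integrable_mul
  rw [integral_add, integral_sub, integral_const_mul, integral_const_mul,
    integral_finsetSum _ (fun j _ => I V (D2 j j)), integral_finsetSum]
  · simp only [i1]
    rw [Finset.sum_congr rfl (fun j _ => integral_finsetSum _ (fun k _ => I (D2 j j) (D2 k k)))]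
    simp only [i2, pow_two, Finset.sum_neg_distrib]
    ring
  · exact fun j _ => integrable_finsetSum _ (fun k _ => I (D2 j j) (D2 k k))
  · exact (I V V).const_mul _
  · exact (integrable_finsetSum _ (fun j _ => I V (D2 j j))).const_mul _
  · exact ((I V V).const_mul _).sub ((integrable_finsetSum _ (fun j _ => I V (D2 j j))).const_mul _)
  · exact integrable_finsetSum _ fun j _ => integrable_finsetSum _ (fun k _ => I (D2 j j) (D2 k k))

end Resolvent

section MaximalInequality

open scoped ENNReal

theorem volume_closedBall_five_mul (x : E3) {r : ℝ} (hr : 0 < r) :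
    volume (closedBall x (5 * r)) = 125 * volume (ball x r) := by
  rw [Measure.addHaar_closedBall_mul volume x (by norm_num) hr.le,
    Measure.addHaar_closedBall_eq_addHaar_ball, Measure.addHaar_ball_center volume x r]
  congr 1
  simp only [finrank_euclideanSpace, Fintype.card_fin]
  norm_num

theorem mul_volume_le_of_forall_ball {A : Set E3} {r : E3 → ℝ} {D : ℝ} {a : ℝ≥0∞} {f : E3 → ℝ≥0∞}
    (hr0 : ∀ x ∈ A, 0 < r x) (hrD : ∀ x ∈ A, r x ≤ D)
    (h : ∀ x ∈ A, a * volume (ball x (r x)) ≤ ∫⁻ y in ball x (r x), f y) :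
    a * volume A ≤ 125 * ∫⁻ y, f y := by
  obtain ⟨s, hsA, hdisj, hcov⟩ := Vitali.exists_disjoint_subfamily_covering_enlargement_closedBall
    A id r D hrD 5 (by norm_num)
  have hdisj' : s.PairwiseDisjoint fun x => ball x (r x) :=
    hdisj.mono_on fun x _ => ball_subset_closedBall
  have hcount : s.Countable := hdisj'.countable_of_isOpen (fun _ _ => isOpen_ball)
    fun x hx => ⟨x, mem_ball_self (hr0 x (hsA hx))⟩
  have hA : A ⊆ ⋃ x ∈ s, closedBall x (5 * r x) := by
    intro x hx
    obtain ⟨b, hb, hsub⟩ := hcov x hx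
    exact Set.mem_biUnion hb (hsub (mem_closedBall_self (hr0 x hx).le))
  have := hcount.to_subtype
  calc a * volume A ≤ a * ∑' x : s, volume (closedBall (x : E3) (5 * r x)) := by
        gcongr
        exact (measure_mono hA).trans (measure_biUnion_le volume hcount _)
    _ = 125 * ∑' x : s, a * volume (ball (x : E3) (r x)) := by
        rw [← ENNReal.tsum_mul_left, ← ENNReal.tsum_mul_left]
        refine tsum_congr fun x => ?_
        rw [volume_closedBall_five_mul _ (hr0 x (hsA x.2))]
        ring
    _ ≤ 125 * ∑' x : s, ∫⁻ y in ball (x : E3) (r x), f y := by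
        gcongr with x
        exact h x (hsA x.2)
    _ = 125 * ∫⁻ y in ⋃ x ∈ s, ball x (r x), f y := by
        rw [lintegral_biUnion hcount (fun _ _ => measurableSet_ball) hdisj']
    _ ≤ 125 * ∫⁻ y, f y := by
        gcongr
        exact Measure.restrict_le_self

theorem lintegral_sq_le_of_forall_ball {F G : E3 → ℝ} (hF : Measurable F) (hG : Measurable G)
    (hF0 : ∀ x, 0 ≤ F x) (hG0 : ∀ x, 0 ≤ G x) {D : ℝ}
    (h : ∀ x (l : ℝ), 0 < l → l < G x → ∃ r, 0 < r ∧ r ≤ D ∧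
      ENNReal.ofReal l * volume (ball x r) ≤ ∫⁻ y in ball x r, ENNReal.ofReal (F y)) :
    ∫⁻ x, ENNReal.ofReal (G x ^ 2) ≤ 1000 * ∫⁻ x, ENNReal.ofReal (F x ^ 2) := by
  have weak : ∀ l : ℝ, 0 < l → ENNReal.ofReal (l / 2) * volume {x | l < G x} ≤
      125 * ∫⁻ y, {y | l / 2 < F y}.indicator (fun y => ENNReal.ofReal (F y)) y := by
    intro l hl
    have hx : ∀ x ∈ {x | l < G x}, ∃ r, 0 < r ∧ r ≤ D ∧ ENNReal.ofReal l * volume (ball x r) ≤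
      ∫⁻ y in ball x r, ENNReal.ofReal (F y) := fun x hx => h x l hl hx
    choose! r hr0 hrD hr using hx
    refine mul_volume_le_of_forall_ball hr0 hrD fun x hx => ?_
    have h1 := hr x hx
    have h2 : ∫⁻ y in ball x (r x), ENNReal.ofReal (F y) ≤
        (∫⁻ y in ball x (r x), {y | l / 2 < F y}.indicator (fun y => ENNReal.ofReal (F y)) y)
          + ENNReal.ofReal (l / 2) * volume (ball x (r x)) := by
      rw [← setLIntegral_const, ← lintegral_add_right _ measurable_const]
      refine lintegral_mono fun y => ?_
      by_cases hy : l / 2 < F y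
      · simp [Set.indicator, hy]
      · simp only [Set.indicator, Set.mem_ofPred_eq, hy, if_false, zero_add]
        exact ENNReal.ofReal_le_ofReal (not_lt.1 hy)
    have h3 : ENNReal.ofReal l * volume (ball x (r x)) =
        ENNReal.ofReal (l / 2) * volume (ball x (r x)) +
          ENNReal.ofReal (l / 2) * volume (ball x (r x)) := by
      rw [← add_mul, ← ENNReal.ofReal_add (by positivity) (by positivity), add_halves]
    rw [h3] at h1
    have hfin : ENNReal.ofReal (l / 2) * volume (ball x (r x)) ≠ ∞ :=
      ENNReal.mul_ne_top ENNReal.ofReal_ne_top measure_ball_lt_top.ne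
    exact (ENNReal.add_le_add_iff_right hfin).1 (h1.trans h2)
  have hm : Measurable (Function.uncurry fun (l : ℝ) (y : E3) =>
      {y | l / 2 < F y}.indicator (fun y => ENNReal.ofReal (F y)) y) := by
    have : (Function.uncurry fun (l : ℝ) (y : E3) =>
      {y | l / 2 < F y}.indicator (fun y => ENNReal.ofReal (F y)) y) =
      {q : ℝ × E3 | q.1 / 2 < F q.2}.indicator (fun q => ENNReal.ofReal (F q.2)) := by
      funext q; rfl
    rw [this]
    refine Measurable.indicator (by fun_prop) (measurableSet_lt (by fun_prop) (by fun_prop))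
  have inner : ∀ y, ∫⁻ l in Set.Ioi (0 : ℝ),
      {y | l / 2 < F y}.indicator (fun y => ENNReal.ofReal (F y)) y =
      2 * ENNReal.ofReal (F y ^ 2) := by
    intro y
    have : ∀ l : ℝ, {y | l / 2 < F y}.indicator (fun y => ENNReal.ofReal (F y)) y
        = (Set.Iio (2 * F y)).indicator (fun _ => ENNReal.ofReal (F y)) l := by
      intro l
      have : l / 2 < F y ↔ l < 2 * F y := by constructor <;> intro <;> linarith
      simp [Set.indicator, this]
    simp only [this]
    rw [lintegral_indicator measurableSet_Iio, setLIntegral_const,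
      Measure.restrict_apply measurableSet_Iio, Set.Iio_inter_Ioi, Real.volume_Ioo, sub_zero,
      ENNReal.ofReal_mul (by norm_num : (0 : ℝ) ≤ 2), pow_two, ENNReal.ofReal_mul (hF0 y)]
    simp only [ENNReal.ofReal_ofNat]
    ring
  have key := lintegral_rpow_eq_lintegral_meas_lt_mul volume (ae_of_all _ hG0) hG.aemeasurable
    (p := 2) (by norm_num)
  simp only [Real.rpow_two, show (2 : ℝ) - 1 = 1 by norm_num, Real.rpow_one] at key
  rw [key]
  calc ENNReal.ofReal 2 * ∫⁻ l in Set.Ioi (0 : ℝ), volume {a | l < G a} * ENNReal.ofReal l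
      ≤ ENNReal.ofReal 2 * ∫⁻ l in Set.Ioi (0 : ℝ),
        250 * ∫⁻ y, {y | l / 2 < F y}.indicator (fun y => ENNReal.ofReal (F y)) y := by
        refine mul_le_mul_right ?_ _
        refine setLIntegral_mono' measurableSet_Ioi fun l (hl : 0 < l) => ?_
        have : ENNReal.ofReal l = 2 * ENNReal.ofReal (l / 2) := by
          rw [← ENNReal.ofReal_ofNat 2, ← ENNReal.ofReal_mul (by norm_num)]; congr 1; ring
        calc volume {a | l < G a} * ENNReal.ofReal l
            = 2 * (ENNReal.ofReal (l / 2) * volume {a | l < G a}) := by rw [this]; ring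
          _ ≤ 2 * (125 * ∫⁻ y, {y | l / 2 < F y}.indicator (fun y => ENNReal.ofReal (F y)) y) := by
            exact mul_le_mul_right (weak l hl) _
          _ = _ := by rw [← mul_assoc]; norm_num
    _ = ENNReal.ofReal 2 * (250 * ∫⁻ y, ∫⁻ l in Set.Ioi (0 : ℝ),
        {y | l / 2 < F y}.indicator (fun y => ENNReal.ofReal (F y)) y) := by
        have hm' : Measurable fun l : ℝ => ∫⁻ y, {y | l / 2 < F y}.indicator
            (fun y => ENNReal.ofReal (F y)) y := hm.lintegral_prod_right'
        rw [lintegral_const_mul _ hm', lintegral_lintegral_swap hm.aemeasurable]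
    _ = 1000 * ∫⁻ x, ENNReal.ofReal (F x ^ 2) := by
        simp only [inner]
        rw [lintegral_const_mul _ (by fun_prop), ← mul_assoc, ← mul_assoc]
        congr 1
        rw [ENNReal.ofReal_ofNat]; norm_num

end MaximalInequality

section HeatKernel

open scoped ENNReal

theorem heatKernel_nonneg {t : ℝ} (ht : 0 < t) (z : E3) : 0 ≤ heatKernel t z := by
  unfold heatKernel; positivity

theorem continuous_heatKernel (t : ℝ) : Continuous (heatKernel t) := by
  unfold heatKernel; fun_prop

theorem heatKernel_sub_comm (t : ℝ) (x y : E3) : heatKernel t (x - y) = heatKernel t (y - x) := by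
  unfold heatKernel; rw [norm_sub_rev]

theorem lintegral_heatKernel {t : ℝ} (ht : 0 < t) :
    ∫⁻ z, ENNReal.ofReal (heatKernel t z) = 1 := by
  have h := GaussianFourier.integral_rexp_neg_mul_sq_norm (V := E3) (b := (4 * t)⁻¹) (by positivity)
  have hInt : Integrable (fun z : E3 => rexp (-(4 * t)⁻¹ * ‖z‖ ^ 2)) := by
    by_contra hc
    rw [integral_undef hc] at h
    have : (0 : ℝ) < (π / (4 * t)⁻¹) ^ ((Module.finrank ℝ E3 : ℝ) / 2) := by positivity
    exact this.ne h
  have e : ∀ z : E3, heatKernel t z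
      = (4 * π * t) ^ (-(3 : ℝ) / 2) * rexp (-(4 * t)⁻¹ * ‖z‖ ^ 2) := by
    intro z; unfold heatKernel; congr 2; field_simp
  rw [← ofReal_integral_eq_lintegral_ofReal _ (ae_of_all _ (heatKernel_nonneg ht))]
  · simp only [e]
    rw [integral_const_mul, h, finrank_euclideanSpace, Fintype.card_fin]
    have : π / (4 * t)⁻¹ = 4 * π * t := by field_simp
    rw [this, ← Real.rpow_add (by positivity)]
    norm_num
  · simp only [funext e]
    exact hInt.const_mul _

theorem norm_mul_heatKernel_le {t : ℝ} (ht : 0 < t) (z : E3) :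
    ‖z‖ * heatKernel t z ≤ 8 * t ^ ((1 : ℝ) / 2) * heatKernel (2 * t) z := by
  unfold heatKernel
  have h1 : (4 * π * t) ^ (-(3 : ℝ) / 2) = 2 ^ ((3 : ℝ) / 2) * (4 * π * (2 * t)) ^ (-(3 : ℝ) / 2) := by
    rw [show 4 * π * (2 * t) = 2 * (4 * π * t) by ring, Real.mul_rpow (x := 2) (by norm_num) (by positivity),
      ← mul_assoc, ← Real.rpow_add (by norm_num)]
    norm_num
  have h2 : rexp (-‖z‖ ^ 2 / (4 * t)) = rexp (-‖z‖ ^ 2 / (4 * (2 * t))) * rexp (-‖z‖ ^ 2 / (4 * (2 * t))) := by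
    rw [← Real.exp_add]; congr 1; field_simp; ring
  have h3 : ‖z‖ * rexp (-‖z‖ ^ 2 / (4 * (2 * t))) ≤ (8 * t) ^ ((1 : ℝ) / 2) := by
    set s := ‖z‖ / √(8 * t) with hs
    have h8 : 0 < √(8 * t) := by positivity
    have hz : ‖z‖ = s * √(8 * t) := by rw [hs]; field_simp
    have he : -‖z‖ ^ 2 / (4 * (2 * t)) = -s ^ 2 := by
      rw [hs, div_pow, Real.sq_sqrt (by positivity)]; field_simp; ring
    rw [he, ← Real.sqrt_eq_rpow, hz, Real.exp_neg]
    have : s ≤ rexp (s ^ 2) := by nlinarith [Real.add_one_le_exp (s ^ 2), sq_nonneg (s - 1)]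
    have : s * (rexp (s ^ 2))⁻¹ ≤ 1 := by
      rw [← div_eq_mul_inv]; exact div_le_one_of_le₀ this (Real.exp_pos _).le
    nlinarith
  have h4 : 2 ^ ((3 : ℝ) / 2) * (8 * t) ^ ((1 : ℝ) / 2) = 8 * t ^ ((1 : ℝ) / 2) := by
    rw [Real.mul_rpow (by norm_num) ht.le, ← mul_assoc]
    congr 1
    rw [show (8 : ℝ) = 2 ^ (3 : ℝ) by norm_num, ← Real.rpow_mul (by norm_num),
      ← Real.rpow_add (by norm_num)]
    norm_num
  rw [h1, h2, ← h4]
  set A := (4 * π * (2 * t)) ^ (-(3 : ℝ) / 2)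
  set E := rexp (-‖z‖ ^ 2 / (4 * (2 * t)))
  have hA : 0 ≤ A := by positivity
  have hE : 0 ≤ E := by positivity
  have h5 : (0 : ℝ) ≤ 2 ^ ((3 : ℝ) / 2) := by positivity
  calc ‖z‖ * (2 ^ ((3 : ℝ) / 2) * A * (E * E)) = (2 ^ ((3 : ℝ) / 2) * A * E) * (‖z‖ * E) := by ring
    _ ≤ (2 ^ ((3 : ℝ) / 2) * A * E) * (8 * t) ^ ((1 : ℝ) / 2) := by gcongr
    _ = _ := by ring

theorem norm_pow_four_mul_heatKernel_le {t : ℝ} (ht : 0 < t) (z : E3) :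
    ‖z‖ ^ 4 * heatKernel t z ≤ 16 * t ^ ((1 : ℝ) / 2) := by
  unfold heatKernel
  set s := ‖z‖ ^ 2 / (4 * t) with hs
  have hz : ‖z‖ ^ 4 = 16 * t ^ 2 * s ^ 2 := by rw [hs]; field_simp; ring
  have he : -‖z‖ ^ 2 / (4 * t) = -s := by rw [hs]; ring
  have hs0 : 0 ≤ s := by positivity
  have h1 : s ^ 2 * rexp (-s) ≤ 1 := by
    rw [Real.exp_neg, ← div_eq_mul_inv]
    refine div_le_one_of_le₀ ?_ (Real.exp_pos _).le
    have h := Real.add_one_le_exp (s / 2)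
    have h2 : rexp s = rexp (s / 2) ^ 2 := by rw [← Real.exp_nat_mul]; congr 1; push_cast; ring
    have h3 := Real.sum_le_exp_of_nonneg hs0 4
    simp only [Finset.sum_range_succ, Finset.sum_range_zero, Nat.factorial] at h3
    norm_num at h3
    nlinarith [sq_nonneg (s - 2), mul_nonneg hs0 (sq_nonneg (s - 2)), mul_nonneg hs0 (sq_nonneg (s - 3))]
  have h2 : (4 * π * t) ^ (-(3 : ℝ) / 2) ≤ t ^ (-(3 : ℝ) / 2) := by
    refine Real.rpow_le_rpow_of_nonpos ht ?_ (by norm_num)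
    nlinarith [Real.pi_gt_three]
  have h3 : t ^ (-(3 : ℝ) / 2) * t ^ 2 = t ^ ((1 : ℝ) / 2) := by
    rw [← Real.rpow_natCast t 2, ← Real.rpow_add ht]; norm_num
  rw [hz, he, ← h3]
  calc 16 * t ^ 2 * s ^ 2 * ((4 * π * t) ^ (-(3 : ℝ) / 2) * rexp (-s))
      = 16 * t ^ 2 * (4 * π * t) ^ (-(3 : ℝ) / 2) * (s ^ 2 * rexp (-s)) := by ring
    _ ≤ 16 * t ^ 2 * t ^ (-(3 : ℝ) / 2) * 1 := by gcongr
    _ = _ := by ring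

theorem exists_le_lintegral_heatKernel :
    ∃ c : ℝ, 0 < c ∧ ∀ t d : ℝ, 0 < t → 0 < d → t ≤ d ^ 2 →
      ENNReal.ofReal c ≤ ∫⁻ z in ball (0 : E3) d, ENNReal.ofReal (heatKernel t z) := by
  refine ⟨(4 * π) ^ (-(3 : ℝ) / 2) * rexp (-1 / 4) * (volume (ball (0 : E3) 1)).toReal, ?_, ?_⟩
  · have : 0 < (volume (ball (0 : E3) 1)).toReal :=
      ENNReal.toReal_pos (measure_ball_pos _ _ one_pos).ne' measure_ball_lt_top.ne
    positivity
  · intro t d ht hd htd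
    have h1 : ball (0 : E3) (√t) ⊆ ball 0 d := ball_subset_ball (by
      rw [← Real.sqrt_sq hd.le]; exact Real.sqrt_le_sqrt htd)
    have h2 : ∀ z ∈ ball (0 : E3) (√t),
        ENNReal.ofReal ((4 * π * t) ^ (-(3 : ℝ) / 2) * rexp (-1 / 4)) ≤ ENNReal.ofReal (heatKernel t z) := by
      intro z hz
      refine ENNReal.ofReal_le_ofReal ?_
      unfold heatKernel
      rw [mem_ball_zero_iff] at hz
      have : ‖z‖ ^ 2 ≤ t := by
        rw [← Real.sq_sqrt ht.le]; gcongr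
      refine mul_le_mul_of_nonneg_left (Real.exp_le_exp.2 ?_) (by positivity)
      rw [div_le_div_iff₀ (by norm_num) (by positivity)]
      nlinarith
    have h3 : volume (ball (0 : E3) (√t)) = ENNReal.ofReal (t ^ ((3 : ℝ) / 2)) * volume (ball (0 : E3) 1) := by
      have := Measure.addHaar_ball_mul volume (0 : E3) (Real.sqrt_nonneg t) 1
      rw [mul_one, finrank_euclideanSpace, Fintype.card_fin] at this
      rw [this, Real.sqrt_eq_rpow, ← Real.rpow_natCast, ← Real.rpow_mul ht.le]
      norm_num
    refine le_trans ?_ (lintegral_mono_set h1)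
    refine le_trans ?_ (setLIntegral_mono' measurableSet_ball h2)
    rw [setLIntegral_const, h3, ENNReal.ofReal_mul (by positivity),
      ENNReal.ofReal_toReal measure_ball_lt_top.ne, ← mul_assoc, ← ENNReal.ofReal_mul (by positivity)]
    have h4 : (4 * π * t) ^ (-(3 : ℝ) / 2) * t ^ ((3 : ℝ) / 2) = (4 * π) ^ (-(3 : ℝ) / 2) := by
      rw [Real.mul_rpow (by positivity) ht.le, mul_assoc, ← Real.rpow_add ht]; norm_num
    refine mul_le_mul_left (ENNReal.ofReal_le_ofReal (le_of_eq ?_)) _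
    rw [← h4]; ring

theorem lintegral_heatKernel_le_of_measure_ball_le {μ : Measure E3} {M : ℝ≥0∞} {t : ℝ} (ht : 0 < t)
    (h : ∀ r, μ (ball 0 r) ≤ M * volume (ball (0 : E3) r)) :
    ∫⁻ z, ENNReal.ofReal (heatKernel t z) ∂μ ≤ M := by
  have hm := (continuous_heatKernel t).measurable
  have hsup : ∀ l > 0, ∃ r, {z : E3 | l < heatKernel t z} = ball 0 r := by
    intro l hl
    set N := (4 * π * t) ^ (-(3 : ℝ) / 2) with hN
    have hN0 : 0 < N := by positivity
    refine ⟨√(4 * t * Real.log (N / l)), ?_⟩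
    ext z
    rw [mem_ball_zero_iff, Set.mem_ofPred_eq, Real.lt_sqrt (norm_nonneg z)]
    have : heatKernel t z = N * rexp (-‖z‖ ^ 2 / (4 * t)) := rfl
    rw [this, ← div_lt_iff₀' hN0, ← Real.log_lt_iff_lt_exp (by positivity), Real.log_div hl.ne' hN0.ne',
      Real.log_div hN0.ne' hl.ne', lt_div_iff₀ (by positivity)]
    constructor <;> intro h <;> linarith
  have key : ∀ ν : Measure E3, ∫⁻ z, ENNReal.ofReal (heatKernel t z) ∂ν
      = ∫⁻ l in Set.Ioi (0 : ℝ), ν {z | l < heatKernel t z} := fun ν =>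
    lintegral_eq_lintegral_meas_lt ν (ae_of_all _ (heatKernel_nonneg ht)) hm.aemeasurable
  rw [key]
  have hmm : Measurable fun l : ℝ => volume {z : E3 | l < heatKernel t z} := by
    refine Antitone.measurable fun a b hab => measure_mono fun z hz => ?_
    exact lt_of_le_of_lt hab hz
  calc ∫⁻ l in Set.Ioi (0 : ℝ), μ {z | l < heatKernel t z}
      ≤ ∫⁻ l in Set.Ioi (0 : ℝ), M * volume {z | l < heatKernel t z} := by
        refine setLIntegral_mono' measurableSet_Ioi fun l hl => ?_
        obtain ⟨r, hr⟩ := hsup l hl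
        rw [hr]; exact h r
    _ = M := by
        rw [lintegral_const_mul _ hmm, ← key volume, lintegral_heatKernel ht, mul_one]

end HeatKernel

section PointwiseBound

open scoped ENNReal

theorem enorm_sub_le_lintegral_fderiv {w : E3 → ℝ} (hw : ContDiff ℝ (⊤ : ℕ∞) w) (x z : E3) :
    ‖w (x + z) - w x‖ₑ ≤ ‖z‖ₑ * ∫⁻ s in Set.Ioc (0 : ℝ) 1, ‖fderiv ℝ w (x + s • z)‖ₑ := by
  have hd : ∀ s : ℝ, HasDerivAt (fun s : ℝ => w (x + s • z)) (fderiv ℝ w (x + s • z) z) s := by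
    intro s
    have h1 : HasDerivAt (fun s : ℝ => x + s • z) z s := by
      simpa using ((hasDerivAt_id s).smul_const z).const_add x
    exact (hw.differentiableAt_of_top _).hasFDerivAt.comp_hasDerivAt s h1
  have hc : Continuous (fderiv ℝ w) := hw.continuous_fderiv (by simp)
  have h2 := intervalIntegral.integral_eq_sub_of_hasDerivAt (a := 0) (b := 1) (fun s _ => hd s)
    (Continuous.intervalIntegrable (by fun_prop) _ _)
  simp only [one_smul, zero_smul, add_zero] at h2
  rw [← h2, intervalIntegral.integral_of_le zero_le_one]
  refine (enorm_integral_le_lintegral_enorm _).trans ?_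
  rw [← lintegral_const_mul _ (by fun_prop)]
  refine lintegral_mono fun s => ?_
  rw [mul_comm]
  exact ContinuousLinearMap.le_opENorm _ _

theorem setLIntegral_ball_comp_add_smul {f : E3 → ℝ≥0∞} (x : E3) {s : ℝ} (hs : 0 < s) (r : ℝ) :
    ENNReal.ofReal (s ^ 3) * ∫⁻ z in ball (0 : E3) r, f (x + s • z)
      = ∫⁻ y in ball x (s * r), f y := by
  have himg : (fun z : E3 => x + s • z) '' ball 0 r = ball x (s * r) := by
    rw [← Set.image_image (fun y => x + y) (fun z => s • z), Set.image_smul, _root_.smul_ball hs.ne',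
      smul_zero, Real.norm_of_nonneg hs.le, Set.image_add_left, preimage_add_ball]
    simp
  have hd : ∀ z ∈ ball (0 : E3) r, HasFDerivWithinAt (fun z : E3 => x + s • z)
      (s • ContinuousLinearMap.id ℝ E3) (ball 0 r) z := fun z _ =>
    (((hasFDerivAt_id z).const_smul s).const_add x).hasFDerivWithinAt
  have hinj : Set.InjOn (fun z : E3 => x + s • z) (ball 0 r) := by
    intro a _ b _ hab
    exact smul_right_injective E3 hs.ne' (add_left_cancel hab)
  have hdet : |(s • ContinuousLinearMap.id ℝ E3).det| = s ^ 3 := by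
    rw [ContinuousLinearMap.det, ContinuousLinearMap.toLinearMap_smul, ContinuousLinearMap.coe_id,
      LinearMap.det_smul, LinearMap.det_id, finrank_euclideanSpace, Fintype.card_fin, mul_one,
      abs_of_pos (by positivity)]
  have := lintegral_image_eq_lintegral_abs_det_fderiv_mul volume measurableSet_ball hd hinj f
  rw [himg, hdet] at this
  rw [this, lintegral_const_mul' _ _ ENNReal.ofReal_ne_top]

theorem lintegral_heatKernel_mul_sub_le {w : E3 → ℝ} (hw : ContDiff ℝ (⊤ : ℕ∞) w) {x : E3}
    {d m t : ℝ} (ht : 0 < t)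
    (h : ∀ s, 0 < s → s ≤ d → ∫⁻ y in ball x s, ‖fderiv ℝ w y‖ₑ ≤ ENNReal.ofReal m * volume (ball x s)) :
    ∫⁻ z in ball (0 : E3) d, ENNReal.ofReal (heatKernel t z) * ‖w (x + z) - w x‖ₑ
      ≤ ENNReal.ofReal (8 * t ^ ((1 : ℝ) / 2) * m) := by
  have hc : Continuous (fderiv ℝ w) := hw.continuous_fderiv (by simp)
  have hk := (continuous_heatKernel (2 * t)).measurable
  set g : E3 → ℝ≥0∞ := fun y => ‖fderiv ℝ w y‖ₑ with hg
  have hgm : Measurable g := by fun_prop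
  have step : ∀ s ∈ Set.Ioc (0 : ℝ) 1,
      ∫⁻ z in ball (0 : E3) d, ENNReal.ofReal (heatKernel (2 * t) z) * g (x + s • z)
        ≤ ENNReal.ofReal m := by
    intro s hs
    have hgs : Measurable fun z => g (x + s • z) := by fun_prop
    have e := lintegral_withDensity_eq_lintegral_mul (volume.restrict (ball (0 : E3) d)) hgs
      (g := fun z => ENNReal.ofReal (heatKernel (2 * t) z)) (by fun_prop)
    have e' : ∫⁻ z in ball (0 : E3) d, ENNReal.ofReal (heatKernel (2 * t) z) * g (x + s • z)
      = ∫⁻ z, ENNReal.ofReal (heatKernel (2 * t) z)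
        ∂((volume.restrict (ball (0 : E3) d)).withDensity fun z => g (x + s • z)) := by
      rw [e]; refine lintegral_congr fun z => ?_
      simp [mul_comm]
    rw [e']
    refine lintegral_heatKernel_le_of_measure_ball_le (by positivity) fun r => ?_
    rw [withDensity_apply _ measurableSet_ball, Measure.restrict_restrict measurableSet_ball]
    have hsub : ball (0 : E3) r ∩ ball 0 d = ball 0 (min r d) := by
      ext z; simp
    rw [hsub]
    rcases le_or_gt (min r d) 0 with h0 | h0
    · rw [ball_eq_empty.2 h0]; simp
    · have h1 := setLIntegral_ball_comp_add_smul (f := g) x hs.1 (min r d)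
      have h2 := h (s * min r d) (by have := hs.1; positivity) (by
        have := min_le_right r d; nlinarith [hs.1, hs.2])
      rw [← h1] at h2
      have h3 : volume (ball x (s * min r d))
          = ENNReal.ofReal (s ^ 3) * volume (ball (0 : E3) (min r d)) := by
        rw [Measure.addHaar_ball_mul volume x hs.1.le, finrank_euclideanSpace, Fintype.card_fin]
      rw [h3, ← mul_assoc, mul_comm (ENNReal.ofReal m), mul_assoc] at h2
      have h4 := (ENNReal.mul_le_mul_iff_right (by have := hs.1; simp; positivity)
        ENNReal.ofReal_ne_top).1 h2
      exact h4.trans (mul_le_mul_right (measure_mono (ball_subset_ball (min_le_left _ _))) _)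
  calc ∫⁻ z in ball (0 : E3) d, ENNReal.ofReal (heatKernel t z) * ‖w (x + z) - w x‖ₑ
      ≤ ∫⁻ z in ball (0 : E3) d, ENNReal.ofReal (8 * t ^ ((1 : ℝ) / 2)) *
          ∫⁻ s in Set.Ioc (0 : ℝ) 1, ENNReal.ofReal (heatKernel (2 * t) z) * g (x + s • z) := by
        refine lintegral_mono fun z => ?_
        rw [lintegral_const_mul _ (by fun_prop), ← mul_assoc]
        refine (mul_le_mul_right (enorm_sub_le_lintegral_fderiv hw x z) _).trans ?_
        rw [← mul_assoc]
        refine mul_le_mul_left ?_ _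
        rw [← ofReal_norm, ← ENNReal.ofReal_mul (heatKernel_nonneg ht z),
          ← ENNReal.ofReal_mul (by positivity), mul_comm]
        exact ENNReal.ofReal_le_ofReal (norm_mul_heatKernel_le ht z)
    _ = ENNReal.ofReal (8 * t ^ ((1 : ℝ) / 2)) * ∫⁻ s in Set.Ioc (0 : ℝ) 1,
          ∫⁻ z in ball (0 : E3) d, ENNReal.ofReal (heatKernel (2 * t) z) * g (x + s • z) := by
        have hmeas : Measurable (Function.uncurry fun (z : E3) (s : ℝ) =>
            ENNReal.ofReal (heatKernel (2 * t) z) * g (x + s • z)) := by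
          unfold Function.uncurry; fun_prop
        have hmeas' : Measurable fun z : E3 => ∫⁻ s in Set.Ioc (0 : ℝ) 1,
            ENNReal.ofReal (heatKernel (2 * t) z) * g (x + s • z) := hmeas.lintegral_prod_right'
        rw [lintegral_const_mul _ hmeas', lintegral_lintegral_swap hmeas.aemeasurable]
    _ ≤ ENNReal.ofReal (8 * t ^ ((1 : ℝ) / 2)) * ∫⁻ s in Set.Ioc (0 : ℝ) 1, ENNReal.ofReal m :=
        mul_le_mul_right (setLIntegral_mono' measurableSet_Ioc step) _
    _ = _ := by
        rw [setLIntegral_const, Real.volume_Ioc, ENNReal.ofReal_mul (p := 8 * t ^ ((1 : ℝ) / 2)) (by positivity)]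
        simp

theorem lintegral_inv_pow_four_mul_le {w : E3 → ℝ} (hw : Continuous w) {K R : ℝ} (hR : 0 < R)
    (hK : 0 ≤ K) (h : ∀ s, R ≤ s → ∫⁻ y in ball (0 : E3) s, ‖w y‖ₑ ≤ ENNReal.ofReal (K * s ^ ((7 : ℝ) / 3))) :
    ∫⁻ y, ENNReal.ofReal (((R + ‖y‖) ^ 4)⁻¹) * ‖w y‖ₑ ≤ ENNReal.ofReal (12 / 5 * K * R ^ (-(5 : ℝ) / 3)) := by
  set μ : Measure E3 := volume.withDensity fun y => ‖w y‖ₑ with hμ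
  have hwm : Measurable fun y => ‖w y‖ₑ := by fun_prop
  have e : ∫⁻ y, ENNReal.ofReal (((R + ‖y‖) ^ 4)⁻¹) * ‖w y‖ₑ = ∫⁻ y, ENNReal.ofReal (((R + ‖y‖) ^ 4)⁻¹) ∂μ := by
    rw [hμ, lintegral_withDensity_eq_lintegral_mul _ hwm (by fun_prop)]
    refine lintegral_congr fun z => ?_
    simp [mul_comm]
  rw [e, lintegral_eq_lintegral_meas_lt μ (ae_of_all _ fun y => by positivity) (by fun_prop)]
  have hb : ∀ l ∈ Set.Ioi (0 : ℝ), μ {y | l < ((R + ‖y‖) ^ 4)⁻¹} ≤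
      (Set.Ioc 0 (R ^ (-4 : ℝ))).indicator (fun l => ENNReal.ofReal (K * l ^ (-(7 : ℝ) / 12))) l := by
    intro l (hl : 0 < l)
    by_cases hlR : l ≤ R ^ (-4 : ℝ)
    · rw [Set.indicator_of_mem (Set.mem_Ioc.2 ⟨hl, hlR⟩)]
      have hR4 : R ≤ l ^ (-(1 : ℝ) / 4) := by
        have := Real.rpow_le_rpow_of_nonpos (z := -(1 : ℝ) / 4) hl hlR (by norm_num)
        rwa [← Real.rpow_mul hR.le, show (-4 : ℝ) * (-1 / 4) = 1 by norm_num, Real.rpow_one] at this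
      have hsub : {y : E3 | l < ((R + ‖y‖) ^ 4)⁻¹} ⊆ ball 0 (l ^ (-(1 : ℝ) / 4)) := by
        intro y hy
        rw [Set.mem_ofPred_eq] at hy
        rw [mem_ball_zero_iff]
        have hp : 0 < R + ‖y‖ := by positivity
        have h1 : R + ‖y‖ < l ^ (-(1 : ℝ) / 4) := by
          have := Real.rpow_lt_rpow_of_neg (z := -(1 : ℝ) / 4) hl hy (by norm_num)
          rwa [← Real.rpow_natCast, ← Real.rpow_neg hp.le, ← Real.rpow_mul hp.le,
            show (-((4 : ℕ) : ℝ)) * (-1 / 4) = 1 by norm_num, Real.rpow_one] at this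
        linarith
      refine (measure_mono hsub).trans ?_
      rw [hμ, withDensity_apply _ measurableSet_ball]
      refine (h _ hR4).trans (le_of_eq ?_)
      rw [← Real.rpow_mul hl.le]; norm_num
    · have : {y : E3 | l < ((R + ‖y‖) ^ 4)⁻¹} = ∅ := by
        ext y
        simp only [Set.mem_ofPred_eq, Set.mem_empty_iff_false, iff_false, not_lt]
        refine le_trans ?_ (not_le.1 hlR).le
        rw [Real.rpow_neg hR.le, show R ^ (4 : ℝ) = R ^ 4 by norm_cast]
        gcongr
        linarith [norm_nonneg y]
      rw [this]; simp
  refine (setLIntegral_mono' measurableSet_Ioi hb).trans ?_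
  rw [lintegral_indicator measurableSet_Ioc, Measure.restrict_restrict measurableSet_Ioc,
    Set.inter_eq_self_of_subset_left Set.Ioc_subset_Ioi_self]
  have hRp : 0 < R ^ (-4 : ℝ) := by positivity
  have hi : IntegrableOn (fun l : ℝ => K * l ^ (-(7 : ℝ) / 12)) (Set.Ioc 0 (R ^ (-4 : ℝ))) := by
    rw [← intervalIntegrable_iff_integrableOn_Ioc_of_le hRp.le]
    exact (intervalIntegral.intervalIntegrable_rpow' (by norm_num)).const_mul _
  rw [← ofReal_integral_eq_lintegral_ofReal hi]
  · refine ENNReal.ofReal_le_ofReal (le_of_eq ?_)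
    rw [← intervalIntegral.integral_of_le hRp.le, intervalIntegral.integral_const_mul,
      integral_rpow (Or.inl (by norm_num)), ← Real.rpow_mul hR.le]
    rw [Real.zero_rpow (by norm_num)]
    norm_num
    ring
  · refine (ae_restrict_iff' measurableSet_Ioc).2 (ae_of_all _ fun l hl => ?_)
    have := hl.1
    simp only [Pi.zero_apply]; positivity

theorem lintegral_compl_ball_heatKernel_mul_le {w : E3 → ℝ} (hw : Continuous w) {K R d t : ℝ} {x : E3}
    (ht : 0 < t) (hd : 0 < d) (hdR : d ≤ R) (hK : 0 ≤ K) (hx : ‖x‖ ≤ 2 * R)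
    (h : ∀ s, R ≤ s → ∫⁻ y in ball (0 : E3) s, ‖w y‖ₑ ≤ ENNReal.ofReal (K * s ^ ((7 : ℝ) / 3))) :
    ∫⁻ z in (ball (0 : E3) d)ᶜ, ‖heatKernel t z * w (x + z)‖ₑ
      ≤ ENNReal.ofReal (t ^ ((1 : ℝ) / 2) * (10000 * K * (R ^ ((7 : ℝ) / 3) / d ^ 4))) := by
  have hR : 0 < R := hd.trans_le hdR
  have hpt : ∀ z ∈ (ball (0 : E3) d)ᶜ, ‖heatKernel t z * w (x + z)‖ₑ ≤
      ENNReal.ofReal (16 * t ^ ((1 : ℝ) / 2) * (4 * R / d) ^ 4) *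
        (ENNReal.ofReal (((R + ‖x + z‖) ^ 4)⁻¹) * ‖w (x + z)‖ₑ) := by
    intro z hz
    have hz : d ≤ ‖z‖ := by simpa using hz
    have hz0 : 0 < ‖z‖ := hd.trans_le hz
    rw [enorm_mul, ← mul_assoc, ← ENNReal.ofReal_mul (by positivity),
      Real.enorm_eq_ofReal (heatKernel_nonneg ht z)]
    refine mul_le_mul_left (ENNReal.ofReal_le_ofReal ?_) _
    have h1 : R + ‖x + z‖ ≤ 4 * R / d * ‖z‖ := by
      have h2 : R ≤ R / d * ‖z‖ := by
        rw [div_mul_eq_mul_div, le_div_iff₀ hd]; gcongr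
      have h3 : 1 * ‖z‖ ≤ R / d * ‖z‖ := by
        gcongr; rwa [one_le_div hd]
      have := norm_add_le x z
      have e : 4 * R / d * ‖z‖ = 4 * (R / d * ‖z‖) := by ring
      linarith
    have h4 := norm_pow_four_mul_heatKernel_le ht z
    rw [← div_eq_mul_inv, le_div_iff₀ (by positivity)]
    calc heatKernel t z * (R + ‖x + z‖) ^ 4 ≤ heatKernel t z * (4 * R / d * ‖z‖) ^ 4 := by
          have := heatKernel_nonneg ht z
          gcongr
      _ = (‖z‖ ^ 4 * heatKernel t z) * (4 * R / d) ^ 4 := by ring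
      _ ≤ _ := by gcongr
  refine (setLIntegral_mono' measurableSet_ball.compl hpt).trans ?_
  rw [lintegral_const_mul' _ _ ENNReal.ofReal_ne_top]
  have h5 : ∫⁻ z in (ball (0 : E3) d)ᶜ, ENNReal.ofReal (((R + ‖x + z‖) ^ 4)⁻¹) * ‖w (x + z)‖ₑ ≤
      ENNReal.ofReal (12 / 5 * K * R ^ (-(5 : ℝ) / 3)) := by
    refine le_trans (setLIntegral_le_lintegral _ _) ?_
    rw [lintegral_add_left_eq_self (fun y => ENNReal.ofReal (((R + ‖y‖) ^ 4)⁻¹) * ‖w y‖ₑ) x]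
    exact lintegral_inv_pow_four_mul_le hw hR hK h
  refine (mul_le_mul_right h5 _).trans ?_
  rw [← ENNReal.ofReal_mul (by positivity)]
  refine ENNReal.ofReal_le_ofReal ?_
  have h6 : R ^ (-(5 : ℝ) / 3) * R ^ 4 = R ^ ((7 : ℝ) / 3) := by
    rw [← Real.rpow_natCast R 4, ← Real.rpow_add hR]; norm_num
  rw [← h6]
  have e : 16 * t ^ ((1 : ℝ) / 2) * (4 * R / d) ^ 4 * (12 / 5 * K * R ^ (-(5 : ℝ) / 3))
    = t ^ ((1 : ℝ) / 2) * ((16 * 256 * 12 / 5) * K * (R ^ (-(5 : ℝ) / 3) * R ^ 4 / d ^ 4)) := by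
    field_simp; ring
  rw [e]
  gcongr
  norm_num

theorem mul_abs_le_of_heat_bound {w : E3 → ℝ} (hw : ContDiff ℝ (⊤ : ℕ∞) w) {K R d t m B c : ℝ} {x : E3}
    (hc : ENNReal.ofReal c ≤ ∫⁻ z in ball (0 : E3) d, ENNReal.ofReal (heatKernel t z))
    (ht : 0 < t) (hd : 0 < d) (hdR : d ≤ R) (hK : 0 ≤ K) (hm : 0 ≤ m) (hx : ‖x‖ ≤ 2 * R)
    (h : ∀ s, R ≤ s → ∫⁻ y in ball (0 : E3) s, ‖w y‖ₑ ≤ ENNReal.ofReal (K * s ^ ((7 : ℝ) / 3)))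
    (hB : |∫ y, heatKernel t (x - y) * w y| ≤ B)
    (hM : ∀ s, 0 < s → s ≤ d →
      ∫⁻ y in ball x s, ‖fderiv ℝ w y‖ₑ ≤ ENNReal.ofReal m * volume (ball x s)) :
    c * |w x| ≤ B + t ^ ((1 : ℝ) / 2) * (8 * m + 10000 * K * (R ^ ((7 : ℝ) / 3) / d ^ 4)) := by
  have hR : 0 < R := hd.trans_le hdR
  have hk := continuous_heatKernel t
  have hwc := hw.continuous
  have near := lintegral_heatKernel_mul_sub_le hw ht hM
  have far := lintegral_compl_ball_heatKernel_mul_le hwc ht hd hdR hK hx h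
  have onball : ∀ f : E3 → ℝ, Continuous f → IntegrableOn f (ball 0 d) := fun f hf =>
    (hf.continuousOn.integrableOn_compact (isCompact_closedBall 0 d)).mono_set ball_subset_closedBall
  have hfar : IntegrableOn (fun z => heatKernel t z * w (x + z)) (ball 0 d)ᶜ :=
    ⟨by fun_prop, far.trans_lt ENNReal.ofReal_lt_top⟩
  have hnear := onball (fun z => heatKernel t z * w (x + z)) (by fun_prop)
  have hInt : Integrable fun z => heatKernel t z * w (x + z) := by
    rw [← integrableOn_univ, ← Set.union_compl_self (ball (0 : E3) d)]
    exact hnear.union hfar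
  have hsplit := integral_add_compl (s := ball (0 : E3) d) measurableSet_ball hInt
  have hchange : ∫ y, heatKernel t (x - y) * w y = ∫ z, heatKernel t z * w (x + z) := by
    rw [← integral_add_left_eq_self (fun y => heatKernel t (x - y) * w y) x]
    refine integral_congr_ae (ae_of_all _ fun z => ?_)
    simp only
    rw [heatKernel_sub_comm, add_sub_cancel_left]
  have hdec : ∫ z in ball (0 : E3) d, heatKernel t z * w (x + z) =
      (∫ z in ball (0 : E3) d, heatKernel t z * (w (x + z) - w x))
        + (∫ z in ball (0 : E3) d, heatKernel t z) * w x := by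
    rw [← integral_mul_const, ← integral_add (onball _ (by fun_prop)) (onball _ (by fun_prop))]
    refine integral_congr_ae (ae_of_all _ fun z => ?_)
    simp only; ring
  have hfar' : |∫ z in (ball (0 : E3) d)ᶜ, heatKernel t z * w (x + z)| ≤
      t ^ ((1 : ℝ) / 2) * (10000 * K * (R ^ ((7 : ℝ) / 3) / d ^ 4)) := by
    have := (enorm_integral_le_lintegral_enorm _).trans far
    rwa [← ofReal_norm, ENNReal.ofReal_le_ofReal_iff (by positivity)] at this
  have hnear' : |∫ z in ball (0 : E3) d, heatKernel t z * (w (x + z) - w x)| ≤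
      8 * t ^ ((1 : ℝ) / 2) * m := by
    have := (enorm_integral_le_lintegral_enorm
      (μ := volume.restrict (ball (0 : E3) d)) fun z => heatKernel t z * (w (x + z) - w x)).trans
      (le_of_eq_of_le (lintegral_congr fun z => by
        rw [enorm_mul, Real.enorm_eq_ofReal (heatKernel_nonneg ht z)]) near)
    rwa [← ofReal_norm, ENNReal.ofReal_le_ofReal_iff (by positivity)] at this
  have hmass : c ≤ ∫ z in ball (0 : E3) d, heatKernel t z := by
    rw [← ofReal_integral_eq_lintegral_ofReal (onball _ hk) (ae_of_all _ (heatKernel_nonneg ht))] at hc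
    exact (ENNReal.ofReal_le_ofReal_iff (integral_nonneg (heatKernel_nonneg ht))).1 hc
  rw [hchange] at hB
  have h1 : (∫ z in ball (0 : E3) d, heatKernel t z) * |w x| ≤ B +
      8 * t ^ ((1 : ℝ) / 2) * m + t ^ ((1 : ℝ) / 2) * (10000 * K * (R ^ ((7 : ℝ) / 3) / d ^ 4)) := by
    rw [← abs_of_nonneg (integral_nonneg (heatKernel_nonneg ht) :
      0 ≤ ∫ z in ball (0 : E3) d, heatKernel t z), ← abs_mul]
    rw [abs_le] at *
    constructor <;> linarith
  have h2 := mul_le_mul_of_nonneg_right hmass (abs_nonneg (w x))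
  calc c * |w x| ≤ _ := h2.trans h1
    _ = _ := by ring

theorem sq_le_of_forall_interpolation {a A b d : ℝ} (ha : 0 ≤ a) (hA : 0 < A) (hb : 0 ≤ b) (hd : 0 < d)
    (h : ∀ t, 0 < t → t ≤ d ^ 2 → a ≤ A * t ^ (-(1 : ℝ) / 2) + t ^ ((1 : ℝ) / 2) * b) :
    a ^ 2 ≤ 4 * (A ^ 2 / d ^ 2 + A * b) := by
  have hs : ∀ s, 0 < s → s ≤ d → a ≤ A / s + s * b := by
    intro s hs hsd
    have := h (s ^ 2) (by positivity) (by gcongr)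
    rwa [← Real.rpow_natCast s 2, ← Real.rpow_mul hs.le, ← Real.rpow_mul hs.le,
      show ((2 : ℕ) : ℝ) * (-1 / 2) = -1 by norm_num, show ((2 : ℕ) : ℝ) * (1 / 2) = 1 by norm_num,
      Real.rpow_one, Real.rpow_neg_one, ← div_eq_mul_inv] at this
  rcases le_or_gt (b * d ^ 2) A with hbd | hbd
  · have h1 := hs d hd le_rfl
    have h2 : d * b ≤ A / d := by rw [le_div_iff₀ hd]; linarith
    have h3 : a ≤ 2 * (A / d) := by linarith
    have h4 : a ^ 2 ≤ (2 * (A / d)) ^ 2 := by gcongr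
    rw [mul_pow, div_pow] at h4
    nlinarith [mul_nonneg hA.le hb]
  · have hb0 : 0 < b := by
      by_contra hc
      have : b = 0 := le_antisymm (not_lt.1 hc) hb
      rw [this] at hbd; linarith
    have h1 := hs (√(A / b)) (by positivity) (by
      rw [Real.sqrt_le_left hd.le, div_le_iff₀ hb0]; linarith)
    have hq : √(A / b) ^ 2 = A / b := Real.sq_sqrt (by positivity)
    have hq0 : 0 < √(A / b) := by positivity
    have h2 : A / √(A / b) = √(A / b) * b := by
      rw [div_eq_iff hq0.ne']
      have : √(A / b) * b * √(A / b) = √(A / b) ^ 2 * b := by ring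
      rw [this, hq]; field_simp
    rw [h2] at h1
    have h4 : a ^ 2 ≤ (√(A / b) * b + √(A / b) * b) ^ 2 := by gcongr
    have h5 : (√(A / b) * b + √(A / b) * b) ^ 2 = 4 * (A * b) := by
      have : (√(A / b) * b + √(A / b) * b) ^ 2 = 4 * (√(A / b) ^ 2 * b ^ 2) := by ring
      rw [this, hq]; field_simp
    have : 0 ≤ A ^ 2 / d ^ 2 := by positivity
    linarith

end PointwiseBound

section FourthPower

open scoped ENNReal

theorem norm_fderiv_sq_le (w : E3 → ℝ) (x : E3) : ‖fderiv ℝ w x‖ ^ 2 ≤ ∑ k, pd k w x ^ 2 := by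
  have hS : 0 ≤ ∑ k, pd k w x ^ 2 := Finset.sum_nonneg fun k _ => sq_nonneg _
  have h : ‖fderiv ℝ w x‖ ≤ √(∑ k, pd k w x ^ 2) := by
    refine ContinuousLinearMap.opNorm_le_bound _ (Real.sqrt_nonneg _) fun v => ?_
    have hv : v = ∑ k, v k • EuclideanSpace.single k (1 : ℝ) := by
      ext i; fin_cases i <;> simp [Fin.sum_univ_three]
    have h1 : fderiv ℝ w x v = ∑ k, v k * pd k w x := by
      conv_lhs => rw [hv]
      rw [map_sum]; simp [pd]
    rw [h1, EuclideanSpace.norm_eq, ← Real.sqrt_mul hS, Real.norm_eq_abs]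
    refine Real.abs_le_sqrt ?_
    simp only [Real.norm_eq_abs, sq_abs]
    rw [mul_comm]
    exact Finset.sum_mul_sq_le_sq_mul_sq _ _ _
  calc ‖fderiv ℝ w x‖ ^ 2 ≤ √(∑ k, pd k w x ^ 2) ^ 2 := by gcongr
    _ = _ := Real.sq_sqrt hS

theorem Continuous.integrableOn_ball {f : E3 → ℝ} (hf : Continuous f) (x : E3) (r : ℝ) :
    IntegrableOn f (ball x r) :=
  (hf.continuousOn.integrableOn_compact (isCompact_closedBall x r)).mono_set ball_subset_closedBall

theorem setIntegral_sq_excess_le {w : E3 → ℝ} (hw : ContDiff ℝ (⊤ : ℕ∞) w) {b κ ρ d : ℝ}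
    (h : ∀ x ∈ ball (0 : E3) ρ, ∀ m, 0 < m → (∀ s, 0 < s → s ≤ d →
      ∫⁻ y in ball x s, ‖fderiv ℝ w y‖ₑ ≤ ENNReal.ofReal m * volume (ball x s)) →
      b * w x ^ 2 ≤ κ + m) :
    ∫ x in ball (0 : E3) ρ, max (b * w x ^ 2 - κ) 0 ^ 2 ≤
      1000 * ∫ x in ball (0 : E3) (ρ + d), ∑ k, pd k w x ^ 2 := by
  have hwc := hw.continuous
  have hc : Continuous (fderiv ℝ w) := hw.continuous_fderiv (by simp)
  set F : E3 → ℝ := (ball (0 : E3) (ρ + d)).indicator fun x => ‖fderiv ℝ w x‖ with hF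
  set G : E3 → ℝ := (ball (0 : E3) ρ).indicator fun x => max (b * w x ^ 2 - κ) 0 with hG
  have hFm : Measurable F := Measurable.indicator (by fun_prop) measurableSet_ball
  have hGm : Measurable G := Measurable.indicator (by fun_prop) measurableSet_ball
  have hF0 : ∀ x, 0 ≤ F x := fun x => Set.indicator_nonneg (fun y _ => norm_nonneg _) x
  have hG0 : ∀ x, 0 ≤ G x := fun x => Set.indicator_nonneg (fun y _ => le_max_right _ _) x
  have key := lintegral_sq_le_of_forall_ball hFm hGm hF0 hG0 (D := d) (by
    intro x l hl hlG
    have hx : x ∈ ball (0 : E3) ρ := by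
      by_contra hx
      rw [hG, Set.indicator_of_notMem hx] at hlG; linarith
    rw [hG, Set.indicator_of_mem hx, lt_max_iff] at hlG
    have hlG' : κ + l < b * w x ^ 2 := by
      rcases hlG with h1 | h1 <;> linarith
    by_contra hcon
    push Not at hcon
    refine absurd (h x hx l hl fun s hs hsd => ?_) (not_le.2 hlG')
    refine le_trans (le_of_eq ?_) (hcon s hs hsd).le
    refine setLIntegral_congr_fun measurableSet_ball fun y hy => ?_
    have : y ∈ ball (0 : E3) (ρ + d) := by
      rw [mem_ball] at *
      linarith [dist_triangle y x 0]
    simp only [hF, Set.indicator_of_mem this, ofReal_norm])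
  have e1 : ∀ x, ENNReal.ofReal (G x ^ 2) = (ball (0 : E3) ρ).indicator
      (fun x => ENNReal.ofReal (max (b * w x ^ 2 - κ) 0 ^ 2)) x := by
    intro x
    by_cases hx : x ∈ ball (0 : E3) ρ
    · rw [hG, Set.indicator_of_mem hx, Set.indicator_of_mem hx]
    · rw [hG, Set.indicator_of_notMem hx, Set.indicator_of_notMem hx]; simp
  have e2 : ∀ x, ENNReal.ofReal (F x ^ 2) = (ball (0 : E3) (ρ + d)).indicator
      (fun x => ENNReal.ofReal (‖fderiv ℝ w x‖ ^ 2)) x := by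
    intro x
    by_cases hx : x ∈ ball (0 : E3) (ρ + d)
    · rw [hF, Set.indicator_of_mem hx, Set.indicator_of_mem hx]
    · rw [hF, Set.indicator_of_notMem hx, Set.indicator_of_notMem hx]; simp
  simp only [e1, e2] at key
  have c1 : Continuous fun x => max (b * w x ^ 2 - κ) 0 ^ 2 := by fun_prop
  have c2 : Continuous fun x => ‖fderiv ℝ w x‖ ^ 2 := by fun_prop
  have c3 : Continuous fun x => ∑ k, pd k w x ^ 2 :=
    continuous_finsetSum _ fun k _ => (contDiff_pd hw k).continuous.pow 2
  rw [lintegral_indicator measurableSet_ball, lintegral_indicator measurableSet_ball,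
    ← ofReal_integral_eq_lintegral_ofReal (c1.integrableOn_ball _ _) (ae_of_all _ fun x => sq_nonneg _),
    ← ofReal_integral_eq_lintegral_ofReal (c2.integrableOn_ball _ _) (ae_of_all _ fun x => sq_nonneg _),
    ← ENNReal.ofReal_ofNat 1000, ← ENNReal.ofReal_mul (by norm_num), ENNReal.ofReal_le_ofReal_iff (by
      have : 0 ≤ ∫ x in ball (0 : E3) (ρ + d), ‖fderiv ℝ w x‖ ^ 2 := integral_nonneg fun x => sq_nonneg _
      positivity)] at key
  refine key.trans (mul_le_mul_of_nonneg_left ?_ (by norm_num))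
  exact integral_mono (c2.integrableOn_ball _ _) (c3.integrableOn_ball _ _) fun x => norm_fderiv_sq_le w x

theorem exists_setIntegral_pow_four_le {w : E3 → ℝ} (hw : ContDiff ℝ (⊤ : ℕ∞) w) {B K : ℝ}
    (hB0 : 0 < B) (hK0 : 0 ≤ K)
    (hB : ∀ t, 0 < t → ∀ x, |∫ y, heatKernel t (x - y) * w y| ≤ B * t ^ (-(1 : ℝ) / 2))
    (hK : ∀ s, 1 ≤ s → ∫⁻ y in ball (0 : E3) s, ‖w y‖ₑ ≤ ENNReal.ofReal (K * s ^ ((7 : ℝ) / 3))) :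
    ∃ C, 0 ≤ C ∧ ∀ R d ρ : ℝ, 1 ≤ R → 0 < d → d ≤ R → ρ ≤ 2 * R →
      ∫ x in ball (0 : E3) ρ, w x ^ 4 ≤
        C * ((∫ x in ball (0 : E3) (ρ + d), ∑ k, pd k w x ^ 2) + R ^ ((23 : ℝ) / 3) / d ^ 8) := by
  obtain ⟨c, hc, hmass⟩ := exists_le_lintegral_heatKernel
  have hwc := hw.continuous
  set b := c ^ 2 / (32 * B) with hb
  have hb0 : 0 < b := by positivity
  set v := (volume (ball (0 : E3) 1)).toReal with hv
  refine ⟨(2000 + 2 * (B ^ 2 / 16 + 2 * 1250 ^ 2 * K ^ 2) * (8 * v)) / b ^ 2, by positivity, ?_⟩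
  intro R d ρ hR hd hdR hρ
  have hR0 : 0 < R := by linarith
  set Q := R ^ ((7 : ℝ) / 3) / d ^ 4 with hQ
  set κ := B / (8 * d ^ 2) + 1250 * K * Q with hκ
  have hQ0 : 0 ≤ Q := by positivity
  have main := setIntegral_sq_excess_le hw (b := b) (κ := κ) (ρ := ρ) (d := d) (by
    intro x hx m hm hM
    rw [mem_ball_zero_iff] at hx
    have h1 := sq_le_of_forall_interpolation (a := c * |w x|) (A := B) (b := 8 * m + 10000 * K * Q)
      (d := d) (by positivity) hB0 (by positivity) hd fun t ht htd =>
      mul_abs_le_of_heat_bound hw (hmass t d ht hd htd) ht hd hdR hK0 hm.le (by linarith)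
        (fun s hs => hK s (hR.trans hs)) (hB t ht x) hM
    rw [mul_pow, sq_abs] at h1
    rw [hb, div_mul_eq_mul_div, div_le_iff₀ (by positivity)]
    refine h1.trans (le_of_eq ?_)
    rw [hκ]; field_simp; ring)
  set I := ∫ x in ball (0 : E3) (ρ + d), ∑ k, pd k w x ^ 2 with hI
  have hvol : (volume (ball (0 : E3) ρ)).toReal ≤ 8 * v * R ^ 3 := by
    have h1 : volume (ball (0 : E3) ρ) ≤ volume (ball (0 : E3) (2 * R)) :=
      measure_mono (ball_subset_ball hρ)
    have h2 := Measure.addHaar_ball_mul volume (0 : E3) (by positivity : 0 ≤ 2 * R) 1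
    rw [mul_one, finrank_euclideanSpace, Fintype.card_fin] at h2
    rw [h2] at h1
    have h3 := ENNReal.toReal_mono (ENNReal.mul_ne_top ENNReal.ofReal_ne_top measure_ball_lt_top.ne) h1
    rw [ENNReal.toReal_mul, ENNReal.toReal_ofReal (by positivity)] at h3
    linarith
  have hpt : ∀ x, b ^ 2 * w x ^ 4 ≤ 2 * max (b * w x ^ 2 - κ) 0 ^ 2 + 2 * κ ^ 2 := by
    intro x
    have h1 : b * w x ^ 2 ≤ max (b * w x ^ 2 - κ) 0 + κ := by
      have := le_max_left (b * w x ^ 2 - κ) 0; linarith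
    have h2 : (b * w x ^ 2) ^ 2 ≤ (max (b * w x ^ 2 - κ) 0 + κ) ^ 2 := by gcongr
    nlinarith [sq_nonneg (max (b * w x ^ 2 - κ) 0 - κ)]
  have hInt : b ^ 2 * ∫ x in ball (0 : E3) ρ, w x ^ 4 ≤
      2 * (∫ x in ball (0 : E3) ρ, max (b * w x ^ 2 - κ) 0 ^ 2)
        + 2 * κ ^ 2 * (volume (ball (0 : E3) ρ)).toReal := by
    have c1 : Continuous fun x => 2 * max (b * w x ^ 2 - κ) 0 ^ 2 := by fun_prop
    have c2 : Continuous fun x => b ^ 2 * w x ^ 4 := by fun_prop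
    have c3 : Continuous fun _ : E3 => 2 * κ ^ 2 := by fun_prop
    have := integral_mono (μ := volume.restrict (ball (0 : E3) ρ)) (c2.integrableOn_ball 0 ρ)
      ((c1.integrableOn_ball 0 ρ).add (c3.integrableOn_ball 0 ρ)) hpt
    rw [integral_const_mul, integral_add' (c1.integrableOn_ball 0 ρ) (c3.integrableOn_ball 0 ρ),
      integral_const_mul, setIntegral_const, smul_eq_mul, mul_comm _ (2 * κ ^ 2)] at this
    exact this
  set T := R ^ ((23 : ℝ) / 3) / d ^ 8 with hT
  have hT0 : 0 ≤ T := by positivity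
  have hI0 : 0 ≤ I := integral_nonneg fun x => Finset.sum_nonneg fun k _ => sq_nonneg _
  have hQT : Q ^ 2 * R ^ 3 = T := by
    rw [hQ, hT, div_pow, ← Real.rpow_natCast (R ^ ((7 : ℝ) / 3)), ← Real.rpow_mul hR0.le,
      div_mul_eq_mul_div, ← Real.rpow_natCast R 3, ← Real.rpow_add hR0, ← pow_mul]
    norm_num
  have hdT : R ^ 3 / d ^ 4 ≤ T := by
    rw [hT, div_le_div_iff₀ (by positivity) (by positivity)]
    have h1 : R ^ 7 ≤ R ^ ((23 : ℝ) / 3) := by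
      rw [← Real.rpow_natCast R 7]; exact Real.rpow_le_rpow_of_exponent_le hR (by norm_num)
    calc R ^ 3 * d ^ 8 = R ^ 3 * d ^ 4 * d ^ 4 := by ring
      _ ≤ R ^ 3 * R ^ 4 * d ^ 4 := by gcongr
      _ = R ^ 7 * d ^ 4 := by ring
      _ ≤ _ := by gcongr
  have hκT : κ ^ 2 * R ^ 3 ≤ (B ^ 2 / 16 + 2 * 1250 ^ 2 * K ^ 2) * T := by
    have h1 : κ ^ 2 ≤ 2 * (B / (8 * d ^ 2)) ^ 2 + 2 * (1250 * K * Q) ^ 2 := by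
      rw [hκ]; nlinarith [sq_nonneg (B / (8 * d ^ 2) - 1250 * K * Q)]
    calc κ ^ 2 * R ^ 3 ≤ (2 * (B / (8 * d ^ 2)) ^ 2 + 2 * (1250 * K * Q) ^ 2) * R ^ 3 := by gcongr
      _ = B ^ 2 / 32 * (R ^ 3 / d ^ 4) + 2 * 1250 ^ 2 * K ^ 2 * (Q ^ 2 * R ^ 3) := by
        field_simp; ring
      _ ≤ B ^ 2 / 16 * T + 2 * 1250 ^ 2 * K ^ 2 * T := by
        rw [hQT]; gcongr; norm_num
      _ = _ := by ring
  rw [div_mul_eq_mul_div, le_div_iff₀ (by positivity), mul_comm]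
  have hv0 : 0 ≤ v := ENNReal.toReal_nonneg
  calc b ^ 2 * ∫ x in ball (0 : E3) ρ, w x ^ 4
      ≤ 2 * (1000 * I) + 2 * κ ^ 2 * (8 * v * R ^ 3) := by
        refine hInt.trans ?_
        gcongr
    _ = 2000 * I + 2 * (κ ^ 2 * R ^ 3) * (8 * v) := by ring
    _ ≤ 2000 * I + 2 * ((B ^ 2 / 16 + 2 * 1250 ^ 2 * K ^ 2) * T) * (8 * v) := by gcongr
    _ ≤ _ := by
        have h1 : 0 ≤ 2 * (B ^ 2 / 16 + 2 * 1250 ^ 2 * K ^ 2) * (8 * v) * I := by positivity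
        nlinarith

end FourthPower

section Cutoff

theorem exists_bound_deriv_smoothTransition :
    ∃ M : ℝ, 0 ≤ M ∧ (∀ t, |deriv Real.smoothTransition t| ≤ M) ∧
      ∀ t, |deriv (deriv Real.smoothTransition) t| ≤ M := by
  have hs : ContDiff ℝ (⊤ : ℕ∞) Real.smoothTransition := Real.smoothTransition.contDiff
  have hd : ContDiff ℝ (⊤ : ℕ∞) (deriv Real.smoothTransition) := by
    have := (contDiff_infty_iff_deriv.1 hs).2
    exact this
  have hdd : Continuous (deriv (deriv Real.smoothTransition)) := (contDiff_infty_iff_deriv.1 hd).2.continuous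
  have hc : HasCompactSupport (deriv Real.smoothTransition) := by
    refine HasCompactSupport.intro (isCompact_Icc (a := (0 : ℝ)) (b := 1)) fun t ht => ?_
    rw [Set.mem_Icc, not_and_or, not_le, not_le] at ht
    rcases ht with ht | ht
    · have : Real.smoothTransition =ᶠ[nhds t] fun _ => 0 := by
        filter_upwards [Iio_mem_nhds ht] with s hs using Real.smoothTransition.zero_of_nonpos (le_of_lt hs)
      rw [this.deriv_eq]; simp
    · have : Real.smoothTransition =ᶠ[nhds t] fun _ => 1 := by
        filter_upwards [Ioi_mem_nhds ht] with s hs using Real.smoothTransition.one_of_one_le (le_of_lt hs)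
      rw [this.deriv_eq]; simp
  obtain ⟨A, hA⟩ := hc.exists_bound_of_continuous hd.continuous
  obtain ⟨B, hB⟩ := hc.deriv.exists_bound_of_continuous hdd
  refine ⟨max A B, ?_, fun t => (hA t).trans (le_max_left _ _), fun t => (hB t).trans (le_max_right _ _)⟩
  exact ((norm_nonneg _).trans (hA 0)).trans (le_max_left _ _)

theorem pd_coord (j k : Fin 3) (x : E3) : pd k (fun y : E3 => y j) x = if j = k then 1 else 0 := by
  have h : HasFDerivAt (fun y : E3 => y j) (EuclideanSpace.proj j : E3 →L[ℝ] ℝ) x :=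
    (EuclideanSpace.proj j : E3 →L[ℝ] ℝ).hasFDerivAt
  simp only [pd, h.fderiv]
  simp

theorem pd_comp {f : ℝ → ℝ} {q : E3 → ℝ} {x : E3} (hf : DifferentiableAt ℝ f (q x))
    (hq : DifferentiableAt ℝ q x) (j : Fin 3) : pd j (fun y => f (q y)) x = deriv f (q x) * pd j q x := by
  have := (hf.hasDerivAt.comp_hasFDerivAt x hq.hasFDerivAt).fderiv
  simp only [pd]
  rw [show (fun y => f (q y)) = f ∘ q from rfl, this]; rfl

theorem exists_cutoff : ∃ M : ℝ, 1 ≤ M ∧ ∀ r ρ : ℝ, 0 ≤ r → r < ρ → ∃ φ : E3 → ℝ,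
    ContDiff ℝ (⊤ : ℕ∞) φ ∧ (∀ x, 0 ≤ φ x) ∧ (∀ x, φ x ≤ 1) ∧ (∀ x, ‖x‖ ≤ r → φ x = 1) ∧
    tsupport φ ⊆ ball 0 ρ ∧ HasCompactSupport φ ∧
    (∀ j x, |pd j φ x| ≤ M / (ρ - r)) ∧ ∀ j k x, |pd k (pd j φ) x| ≤ M / (ρ - r) ^ 2 := by
  obtain ⟨A, hA0, hA, hA'⟩ := exists_bound_deriv_smoothTransition
  refine ⟨1 + 30 * A, by linarith, fun r ρ hr hrρ => ?_⟩
  set σ := (r + ρ) / 2 with hσ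
  set e := σ - r with he
  have he0 : 0 < e := by rw [he, hσ]; linarith
  have h2e : ρ - r = 2 * e := by rw [he, hσ]; ring
  set T := σ ^ 2 - r ^ 2 with hT
  have hσ0 : 0 < σ := by linarith
  have hTe : e * σ ≤ T := by rw [hT, he]; nlinarith
  have hT0 : 0 < T := lt_of_lt_of_le (by positivity) hTe
  have heσ : e ≤ σ := by linarith
  set q : E3 → ℝ := fun x => (σ ^ 2 - ‖x‖ ^ 2) * T⁻¹ with hq
  have hqs : ContDiff ℝ (⊤ : ℕ∞) q := (contDiff_const.sub (contDiff_norm_sq ℝ)).mul contDiff_const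
  have hs : ContDiff ℝ (⊤ : ℕ∞) Real.smoothTransition := Real.smoothTransition.contDiff
  have hsd : ContDiff ℝ (⊤ : ℕ∞) (deriv Real.smoothTransition) := (contDiff_infty_iff_deriv.1 hs).2
  set φ : E3 → ℝ := fun x => Real.smoothTransition (q x) with hφ
  have hφs : ContDiff ℝ (⊤ : ℕ∞) φ := hs.comp hqs
  have hzero : ∀ x, σ ≤ ‖x‖ → φ x = 0 := by
    intro x hx
    refine Real.smoothTransition.zero_of_nonpos ?_
    have : σ ^ 2 ≤ ‖x‖ ^ 2 := by gcongr
    exact mul_nonpos_of_nonpos_of_nonneg (by linarith) (by positivity)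
  have hsupp : tsupport φ ⊆ closedBall 0 σ := by
    refine closure_minimal (fun x hx => ?_) isClosed_closedBall
    rw [mem_closedBall_zero_iff]
    by_contra hc
    exact hx (hzero x (not_le.1 hc).le)
  have hpdq : ∀ j x, pd j q x = -2 * T⁻¹ * x j := by
    intro j x
    have : q = fun y : E3 => σ ^ 2 * T⁻¹ - ∑ i, T⁻¹ * (y i * y i) := by
      funext y
      rw [hq]
      simp only [EuclideanSpace.norm_sq_eq, Real.norm_eq_abs, sq_abs, Fin.sum_univ_three]
      ring
    have hco : ∀ i, DifferentiableAt ℝ (fun y : E3 => y i) x := fun i =>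
      (EuclideanSpace.proj i : E3 →L[ℝ] ℝ).differentiableAt
    rw [this, pd_sub (by fun_prop) (by fun_prop), pd_sum (fun i _ => by fun_prop)]
    have h1 : ∀ i, pd j (fun y : E3 => T⁻¹ * (y i * y i)) x = if i = j then 2 * T⁻¹ * x j else 0 := by
      intro i
      have hii : DifferentiableAt ℝ (fun y : E3 => y i * y i) x := (hco i).mul (hco i)
      rw [pd_const_mul _ hii, pd_mul (hco i) (hco i), pd_coord]
      split_ifs with hij
      · subst hij; ring
      · ring
    simp only [h1, Finset.sum_ite_eq', Finset.mem_univ, if_true]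
    simp [pd]
  have hpd : ∀ j x, pd j φ x = deriv Real.smoothTransition (q x) * (-2 * T⁻¹ * x j) := by
    intro j x
    rw [hφ, pd_comp (hs.differentiable (by simp) _) (hqs.differentiableAt_of_top x), hpdq]
  have hpd2 : ∀ j k x, pd k (pd j φ) x =
      deriv (deriv Real.smoothTransition) (q x) * (-2 * T⁻¹ * x k) * (-2 * T⁻¹ * x j)
        + deriv Real.smoothTransition (q x) * (-2 * T⁻¹ * if j = k then 1 else 0) := by
    intro j k x
    have hco : DifferentiableAt ℝ (fun y : E3 => y j) x :=
      (EuclideanSpace.proj j : E3 →L[ℝ] ℝ).differentiableAt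
    have hd1 : DifferentiableAt ℝ (fun y => deriv Real.smoothTransition (q y)) x :=
      (hsd.comp hqs).differentiableAt_of_top x
    have hd2 : DifferentiableAt ℝ (fun y : E3 => -2 * T⁻¹ * y j) x := hco.const_mul _
    rw [funext (hpd j), pd_mul hd1 hd2,
      pd_comp (hsd.differentiable (by simp) _) (hqs.differentiableAt_of_top x), hpdq,
      pd_const_mul _ hco, pd_coord]
  have hcoord : ∀ (x : E3) j, ‖x‖ ≤ σ → |2 * T⁻¹ * x j| ≤ 2 / e := by
    intro x j hx
    have h1 : |x j| ≤ σ := (PiLp.norm_apply_le x j).trans hx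
    rw [abs_mul, abs_of_pos (by positivity), le_div_iff₀ he0]
    calc 2 * T⁻¹ * |x j| * e ≤ 2 * T⁻¹ * σ * e := by gcongr
      _ = 2 * (T⁻¹ * (e * σ)) := by ring
      _ ≤ 2 * (T⁻¹ * T) := by gcongr
      _ = 2 := by rw [inv_mul_cancel₀ hT0.ne', mul_one]
  have hTi : T⁻¹ ≤ 1 / e ^ 2 := by
    rw [inv_eq_one_div]
    refine one_div_le_one_div_of_le (by positivity) (le_trans ?_ hTe)
    nlinarith
  refine ⟨φ, hφs, fun x => Real.smoothTransition.nonneg _, fun x => Real.smoothTransition.le_one _,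
    ?_, hsupp.trans (closedBall_subset_ball (by linarith)),
    HasCompactSupport.of_support_subset_isCompact (isCompact_closedBall 0 σ) ((subset_tsupport φ).trans hsupp), ?_, ?_⟩
  · intro x hx
    refine Real.smoothTransition.one_of_one_le ?_
    rw [hq]
    simp only
    rw [← div_eq_mul_inv, one_le_div hT0, hT]
    have : ‖x‖ ^ 2 ≤ r ^ 2 := by gcongr
    linarith
  · intro j x
    by_cases hx : ‖x‖ ≤ σ
    · rw [hpd, abs_mul, h2e]
      have h1 : |-2 * T⁻¹ * x j| ≤ 2 / e := by
        rw [show -2 * T⁻¹ * x j = -(2 * T⁻¹ * x j) by ring, abs_neg]; exact hcoord x j hx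
      calc _ ≤ A * (2 / e) := by gcongr; exact hA _
        _ = (4 * A) / (2 * e) := by field_simp; ring
        _ ≤ _ := by gcongr; linarith
    · have h0 : pd j φ x = 0 := image_eq_zero_of_notMem_tsupport fun hc =>
        hx (mem_closedBall_zero_iff.1 (hsupp (tsupport_pd_subset _ _ hc)))
      rw [h0, abs_zero, h2e]; positivity
  · intro j k x
    by_cases hx : ‖x‖ ≤ σ
    · rw [hpd2, h2e]
      have h1 : ∀ j, |-2 * T⁻¹ * x j| ≤ 2 / e := fun j => by
        rw [show -2 * T⁻¹ * x j = -(2 * T⁻¹ * x j) by ring, abs_neg]; exact hcoord x j hx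
      have h2 : |(-2 * T⁻¹ * if j = k then 1 else 0 : ℝ)| ≤ 2 * (1 / e ^ 2) := by
        split_ifs
        · rw [mul_one, abs_mul, abs_of_pos (inv_pos.2 hT0)]; norm_num; simpa using hTi
        · rw [mul_zero, abs_zero]; positivity
      calc _ ≤ A * (2 / e) * (2 / e) + A * (2 * (1 / e ^ 2)) := by
            refine (abs_add_le _ _).trans ?_
            rw [abs_mul, abs_mul, abs_mul (deriv Real.smoothTransition (q x))]
            gcongr
            · exact hA' _
            · exact h1 k
            · exact h1 j
            · exact hA _
        _ = (24 * A) / (2 * e) ^ 2 := by field_simp; ring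
        _ ≤ _ := by gcongr; linarith
    · have h0 : pd k (pd j φ) x = 0 := image_eq_zero_of_notMem_tsupport fun hc =>
        hx (mem_closedBall_zero_iff.1 (hsupp (tsupport_pd_subset _ _ (tsupport_pd_subset _ _ hc))))
      rw [h0, abs_zero, h2e]; positivity

end Cutoff

section Corrector

open scoped SchwartzMap FourierTransform LineDeriv Laplacian

/-- The partial derivative as a map on Schwartz functions. -/
def schwartzPd (j : Fin 3) (f : 𝓢(E3, ℝ)) : 𝓢(E3, ℝ) := ∂_{(EuclideanSpace.single j 1 : E3)} f

theorem coe_schwartzPd (j : Fin 3) (f : 𝓢(E3, ℝ)) : ⇑(schwartzPd j f) = pd j f :=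
  (SchwartzMap.pd_eq_lineDerivOp j f).symm

theorem SchwartzMap.contDiff_top (f : 𝓢(E3, ℝ)) : ContDiff ℝ (⊤ : ℕ∞) f := f.smooth _

theorem SchwartzMap.integrable_sq (f : 𝓢(E3, ℝ)) : Integrable (fun x => f x ^ 2) := by
  simpa only [pow_two] using SchwartzMap.integrable_mul f f

theorem lap_sum_pd {V : Fin 3 → 𝓢(E3, ℝ)} (x : E3) :
    lap (fun y => ∑ i, pd i (V i) y) x = ∑ i, pd i (fun y => lap (V i) y) x := by
  have hV : ∀ i, ContDiff ℝ (⊤ : ℕ∞) (V i) := fun i => (V i).contDiff_top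
  have h1 : ∀ j, pd j (fun y => ∑ i, pd i (V i) y) = fun y => ∑ i, pd i (pd j (V i)) y := by
    intro j; funext y
    rw [pd_sum fun i _ => (contDiff_pd (hV i) i).differentiableAt_of_top y]
    exact Finset.sum_congr rfl fun i _ => pd_comm (hV i) j i y
  simp only [lap, h1]
  have h2 : ∀ j, pd j (fun y => ∑ i, pd i (pd j (V i)) y) x = ∑ i, pd i (pd j (pd j (V i))) x := by
    intro j
    rw [pd_sum fun i _ => (contDiff_pd (contDiff_pd (hV i) j) i).differentiableAt_of_top x]
    exact Finset.sum_congr rfl fun i _ => pd_comm (contDiff_pd (hV i) j) j i x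
  simp only [h2]
  rw [Finset.sum_comm]
  refine Finset.sum_congr rfl fun i _ => ?_
  rw [pd_sum fun j _ => (contDiff_pd (contDiff_pd (hV i) j) j).differentiableAt_of_top x]

theorem contDiff_lap {f : E3 → ℝ} (hf : ContDiff ℝ (⊤ : ℕ∞) f) : ContDiff ℝ (⊤ : ℕ∞) (lap f) :=
  ContDiff.sum fun j _ => contDiff_pd (contDiff_pd hf j) j

theorem resolvent_div {lam : ℝ} {V g : Fin 3 → 𝓢(E3, ℝ)}
    (h : ∀ i x, lam * V i x - lap (V i) x = g i x) (x : E3) :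
    lam * (∑ i, pd i (V i) x) - lap (fun y => ∑ i, pd i (V i) y) x = ∑ i, pd i (g i) x := by
  rw [lap_sum_pd, Finset.mul_sum, ← Finset.sum_sub_distrib]
  refine Finset.sum_congr rfl fun i _ => ?_
  have hV := (V i).contDiff_top
  rw [← pd_const_mul lam (hV.differentiableAt_of_top x) i,
    ← pd_sub ((contDiff_const.mul hV).differentiableAt_of_top x)
      ((contDiff_lap hV).differentiableAt_of_top x)]
  exact congrArg (fun f => pd i f x) (funext fun y => h i y)

theorem sum_pd_sum_pd_antisymm {Ω : Fin 3 → Fin 3 → E3 → ℝ}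
    (hΩ : ∀ i j, ContDiff ℝ (⊤ : ℕ∞) (Ω i j)) (ha : ∀ i j x, Ω i j x = -Ω j i x) (x : E3) :
    ∑ i, pd i (fun y => ∑ j, pd j (Ω i j) y) x = 0 := by
  have h1 : ∀ i, pd i (fun y => ∑ j, pd j (Ω i j) y) x = ∑ j, pd i (pd j (Ω i j)) x := fun i =>
    pd_sum (fun j _ => (contDiff_pd (hΩ i j) j).differentiableAt_of_top x) i
  have h2 : ∀ i j, pd i (pd j (Ω i j)) x = -pd j (pd i (Ω j i)) x := by
    intro i j
    have e : Ω i j = fun y => (-1) * Ω j i y := by funext y; rw [ha i j]; ring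
    have e' : pd j (Ω i j) = fun y => (-1) * pd j (Ω j i) y := by
      funext y; rw [e, pd_const_mul _ ((hΩ j i).differentiableAt_of_top y)]
    rw [e', pd_const_mul _ ((contDiff_pd (hΩ j i) j).differentiableAt_of_top x), pd_comm (hΩ j i)]
    ring
  simp only [h1]
  have h3 : ∑ i, ∑ j, pd i (pd j (Ω i j)) x = -∑ i, ∑ j, pd i (pd j (Ω i j)) x := by
    conv_lhs => rw [Finset.sum_comm]
    rw [← Finset.sum_neg_distrib]
    refine Finset.sum_congr rfl fun j _ => ?_
    rw [← Finset.sum_neg_distrib]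
    exact Finset.sum_congr rfl fun i _ => h2 i j
  linarith

/-- The commutator field that restores the divergence-free condition after a cut-off. -/
def corrector (lam : ℝ) (φ : E3 → ℝ) (V : Fin 3 → E3 → ℝ) (H : E3 → ℝ) (i : Fin 3) (x : E3) : ℝ :=
  (∑ j, pd j φ x * (pd i (V j) x - pd j (V i) x)) + φ x * (pd i H x - lam * V i x)

theorem contDiff_corrector {lam : ℝ} {φ : E3 → ℝ} {V : Fin 3 → E3 → ℝ} {H : E3 → ℝ}
    (hφ : ContDiff ℝ (⊤ : ℕ∞) φ) (hV : ∀ i, ContDiff ℝ (⊤ : ℕ∞) (V i))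
    (hH : ContDiff ℝ (⊤ : ℕ∞) H) (i : Fin 3) : ContDiff ℝ (⊤ : ℕ∞) (corrector lam φ V H i) :=
  (ContDiff.sum fun j _ => (contDiff_pd hφ j).mul
    ((contDiff_pd (hV j) i).sub (contDiff_pd (hV i) j))).add
    (hφ.mul ((contDiff_pd hH i).sub (contDiff_const.mul (hV i))))

theorem tsupport_corrector_subset (lam : ℝ) (φ : E3 → ℝ) (V : Fin 3 → E3 → ℝ) (H : E3 → ℝ)
    (i : Fin 3) : tsupport (corrector lam φ V H i) ⊆ tsupport φ := by
  refine closure_minimal (fun x hx => ?_) (isClosed_tsupport φ)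
  by_contra hc
  refine hx ?_
  have h0 : φ x = 0 := image_eq_zero_of_notMem_tsupport hc
  have h1 : ∀ j, pd j φ x = 0 := fun j =>
    image_eq_zero_of_notMem_tsupport fun h => hc (tsupport_pd_subset φ j h)
  simp [corrector, h0, h1]

theorem pd_corrector {lam : ℝ} {φ : E3 → ℝ} {V : Fin 3 → E3 → ℝ} {H : E3 → ℝ}
    (hφ : ContDiff ℝ (⊤ : ℕ∞) φ) (hV : ∀ i, ContDiff ℝ (⊤ : ℕ∞) (V i))
    (hH : ContDiff ℝ (⊤ : ℕ∞) H) (i k : Fin 3) (x : E3) :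
    pd k (corrector lam φ V H i) x =
      (∑ j, (pd k (pd j φ) x * (pd i (V j) x - pd j (V i) x)
        + pd j φ x * (pd k (pd i (V j)) x - pd k (pd j (V i)) x)))
      + (pd k φ x * (pd i H x - lam * V i x) + φ x * (pd k (pd i H) x - lam * pd k (V i) x)) := by
  have hA : ∀ j, ContDiff ℝ (⊤ : ℕ∞) (fun y => pd i (V j) y - pd j (V i) y) := fun j =>
    (contDiff_pd (hV j) i).sub (contDiff_pd (hV i) j)
  have hl : ContDiff ℝ (⊤ : ℕ∞) (fun y => lam * V i y) := contDiff_const.mul (hV i)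
  have hB : ContDiff ℝ (⊤ : ℕ∞) (fun y => pd i H y - lam * V i y) := (contDiff_pd hH i).sub hl
  have hpA : ∀ j, ContDiff ℝ (⊤ : ℕ∞) (fun y => pd j φ y * (pd i (V j) y - pd j (V i) y)) := fun j =>
    (contDiff_pd hφ j).mul (hA j)
  have hpB : ContDiff ℝ (⊤ : ℕ∞) (fun y => φ y * (pd i H y - lam * V i y)) := hφ.mul hB
  have hS : ContDiff ℝ (⊤ : ℕ∞) (fun y => ∑ j, pd j φ y * (pd i (V j) y - pd j (V i) y)) :=
    ContDiff.sum fun j _ => hpA j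
  unfold corrector
  rw [pd_add (hS.differentiableAt_of_top x) (hpB.differentiableAt_of_top x),
    pd_sum fun j _ => (hpA j).differentiableAt_of_top x,
    pd_mul (hφ.differentiableAt_of_top x) (hB.differentiableAt_of_top x),
    pd_sub ((contDiff_pd hH i).differentiableAt_of_top x) (hl.differentiableAt_of_top x),
    pd_const_mul _ ((hV i).differentiableAt_of_top x)]
  congr 1
  refine Finset.sum_congr rfl fun j _ => ?_
  rw [pd_mul ((contDiff_pd hφ j).differentiableAt_of_top x) ((hA j).differentiableAt_of_top x),
    pd_sub ((contDiff_pd (hV j) i).differentiableAt_of_top x)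
      ((contDiff_pd (hV i) j).differentiableAt_of_top x)]

theorem add_corrector_eq {lam : ℝ} {φ : E3 → ℝ} {V : Fin 3 → E3 → ℝ}
    (hφ : ContDiff ℝ (⊤ : ℕ∞) φ) (hV : ∀ i, ContDiff ℝ (⊤ : ℕ∞) (V i)) (i : Fin 3) (x : E3) :
    φ x * (lam * V i x - lap (V i) x) + corrector lam φ V (fun y => ∑ j, pd j (V j) y) i x
      = ∑ j, pd j (fun y => φ y * (pd i (V j) y - pd j (V i) y)) x := by
  have hA : ∀ j, ContDiff ℝ (⊤ : ℕ∞) (fun y => pd i (V j) y - pd j (V i) y) := fun j =>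
    (contDiff_pd (hV j) i).sub (contDiff_pd (hV i) j)
  have h1 : ∀ j, pd j (fun y => φ y * (pd i (V j) y - pd j (V i) y)) x
      = pd j φ x * (pd i (V j) x - pd j (V i) x) + φ x * (pd i (pd j (V j)) x - pd j (pd j (V i)) x) := by
    intro j
    rw [pd_mul (hφ.differentiableAt_of_top x) ((hA j).differentiableAt_of_top x),
      pd_sub ((contDiff_pd (hV j) i).differentiableAt_of_top x)
        ((contDiff_pd (hV i) j).differentiableAt_of_top x), pd_comm (hV j) j i]
  simp only [h1, corrector, lap]
  rw [pd_sum fun j _ => (contDiff_pd (hV j) j).differentiableAt_of_top x, Finset.sum_add_distrib,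
    ← Finset.mul_sum, Finset.sum_sub_distrib]
  ring

theorem sum_pd_add_corrector {lam : ℝ} {φ : E3 → ℝ} {V : Fin 3 → E3 → ℝ}
    (hφ : ContDiff ℝ (⊤ : ℕ∞) φ) (hV : ∀ i, ContDiff ℝ (⊤ : ℕ∞) (V i)) (x : E3) :
    ∑ i, pd i (fun y => φ y * (lam * V i y - lap (V i) y)
      + corrector lam φ V (fun z => ∑ j, pd j (V j) z) i y) x = 0 := by
  simp only [add_corrector_eq hφ hV]
  refine sum_pd_sum_pd_antisymm (fun i j => hφ.mul
    ((contDiff_pd (hV j) i).sub (contDiff_pd (hV i) j))) (fun i j x => by ring) x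

theorem sq_pd_corrector_le {lam a b : ℝ} {φ : E3 → ℝ} {V : Fin 3 → E3 → ℝ} {H : E3 → ℝ}
    (hφ : ContDiff ℝ (⊤ : ℕ∞) φ) (hV : ∀ i, ContDiff ℝ (⊤ : ℕ∞) (V i))
    (hH : ContDiff ℝ (⊤ : ℕ∞) H) (i k : Fin 3) (x : E3) (h0 : |φ x| ≤ 1)
    (h1 : ∀ j, |pd j φ x| ≤ a) (h2 : ∀ j k, |pd k (pd j φ) x| ≤ b) :
    pd k (corrector lam φ V H i) x ^ 2 ≤ 256 *
      (b ^ 2 * (∑ i, ∑ j, pd j (V i) x ^ 2) + a ^ 2 * (∑ i, ∑ j, ∑ k, pd k (pd j (V i)) x ^ 2)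
        + ∑ j, ∑ k, pd k (pd j H) x ^ 2 + a ^ 2 * (∑ j, pd j H x ^ 2)
        + a ^ 2 * (lam ^ 2 * ∑ i, V i x ^ 2) + lam ^ 2 * (∑ i, ∑ j, pd j (V i) x ^ 2)) := by
  have pT1 : 0 ≤ ∑ i, ∑ j, pd j (V i) x ^ 2 :=
    Finset.sum_nonneg fun _ _ => Finset.sum_nonneg fun _ _ => sq_nonneg _
  have pT2 : 0 ≤ ∑ i, ∑ j, ∑ k, pd k (pd j (V i)) x ^ 2 :=
    Finset.sum_nonneg fun _ _ => Finset.sum_nonneg fun _ _ => Finset.sum_nonneg fun _ _ => sq_nonneg _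
  have pH2 : 0 ≤ ∑ j, ∑ k, pd k (pd j H) x ^ 2 :=
    Finset.sum_nonneg fun _ _ => Finset.sum_nonneg fun _ _ => sq_nonneg _
  have pH1 : 0 ≤ ∑ j, pd j H x ^ 2 :=
    Finset.sum_nonneg fun _ _ => sq_nonneg _
  have pT0 : 0 ≤ ∑ i, V i x ^ 2 :=
    Finset.sum_nonneg fun _ _ => sq_nonneg _
  have m1 : ∀ i j, pd j (V i) x ^ 2 ≤ ∑ i, ∑ j, pd j (V i) x ^ 2 := fun i j =>
    (Finset.single_le_sum (f := fun j => pd j (V i) x ^ 2) (fun _ _ => sq_nonneg _) (Finset.mem_univ j)).trans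
      (Finset.single_le_sum (f := fun i => ∑ j, pd j (V i) x ^ 2) (fun _ _ => Finset.sum_nonneg fun _ _ => sq_nonneg _) (Finset.mem_univ i))
  have m2 : ∀ i j k, pd k (pd j (V i)) x ^ 2 ≤ ∑ i, ∑ j, ∑ k, pd k (pd j (V i)) x ^ 2 := fun i j k =>
    ((Finset.single_le_sum (f := fun k => pd k (pd j (V i)) x ^ 2) (fun _ _ => sq_nonneg _) (Finset.mem_univ k)).trans
      (Finset.single_le_sum (f := fun j => ∑ k, pd k (pd j (V i)) x ^ 2) (fun _ _ => Finset.sum_nonneg fun _ _ => sq_nonneg _) (Finset.mem_univ j))).trans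
      (Finset.single_le_sum (f := fun i => ∑ j, ∑ k, pd k (pd j (V i)) x ^ 2) (fun _ _ => Finset.sum_nonneg fun _ _ => Finset.sum_nonneg fun _ _ => sq_nonneg _) (Finset.mem_univ i))
  have m3 : ∀ j k, pd k (pd j H) x ^ 2 ≤ ∑ j, ∑ k, pd k (pd j H) x ^ 2 := fun j k =>
    (Finset.single_le_sum (f := fun k => pd k (pd j H) x ^ 2) (fun _ _ => sq_nonneg _) (Finset.mem_univ k)).trans
      (Finset.single_le_sum (f := fun j => ∑ k, pd k (pd j H) x ^ 2) (fun _ _ => Finset.sum_nonneg fun _ _ => sq_nonneg _) (Finset.mem_univ j))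
  have m4 : ∀ j, pd j H x ^ 2 ≤ ∑ j, pd j H x ^ 2 := fun j =>
    Finset.single_le_sum (f := fun j => pd j H x ^ 2) (fun _ _ => sq_nonneg _) (Finset.mem_univ j)
  have m5 : ∀ i, V i x ^ 2 ≤ ∑ i, V i x ^ 2 := fun j =>
    Finset.single_le_sum (f := fun j => V j x ^ 2) (fun _ _ => sq_nonneg _) (Finset.mem_univ j)
  generalize ∑ i, ∑ j, ∑ k, pd k (pd j (V i)) x ^ 2 = T2 at *
  generalize ∑ i, ∑ j, pd j (V i) x ^ 2 = T1 at *
  generalize ∑ j, ∑ k, pd k (pd j H) x ^ 2 = H2 at *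
  generalize ∑ j, pd j H x ^ 2 = H1 at *
  generalize ∑ i, V i x ^ 2 = T0 at *
  set Y := b ^ 2 * T1 + a ^ 2 * T2 + H2 + a ^ 2 * H1 + a ^ 2 * (lam ^ 2 * T0) + lam ^ 2 * T1 with hY
  have q1 : 0 ≤ b ^ 2 * T1 := by positivity
  have q2 : 0 ≤ a ^ 2 * T2 := by positivity
  have q3 : 0 ≤ a ^ 2 * H1 := by positivity
  have q4 : 0 ≤ a ^ 2 * (lam ^ 2 * T0) := by positivity
  have q5 : 0 ≤ lam ^ 2 * T1 := by positivity
  have pY : 0 ≤ Y := by positivity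
  have key : ∀ {s t c T : ℝ}, |s| ≤ c → t ^ 2 ≤ T → c ^ 2 * T ≤ Y → |s * t| ≤ √Y := by
    intro s t c T hs ht hc
    refine Real.abs_le_sqrt ?_
    rw [mul_pow]
    have : s ^ 2 ≤ c ^ 2 := by rw [← sq_abs]; gcongr
    calc s ^ 2 * t ^ 2 ≤ c ^ 2 * T := by gcongr
      _ ≤ Y := hc
  have k1 : ∀ j, |pd k (pd j φ) x * (pd i (V j) x - pd j (V i) x)
        + pd j φ x * (pd k (pd i (V j)) x - pd k (pd j (V i)) x)| ≤ 4 * √Y := by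
    intro j
    have e1 := abs_le.1 (key (h2 j k) (m1 j i) (by linarith))
    have e2 := abs_le.1 (key (h2 j k) (m1 i j) (by linarith))
    have e3 := abs_le.1 (key (h1 j) (m2 j i k) (by linarith))
    have e4 := abs_le.1 (key (h1 j) (m2 i j k) (by linarith))
    rw [abs_le]
    constructor <;> nlinarith
  have k2 : |pd k φ x * (pd i H x - lam * V i x) + φ x * (pd k (pd i H) x - lam * pd k (V i) x)|
      ≤ 4 * √Y := by
    have e1 := abs_le.1 (key (h1 k) (m4 i) (by linarith))
    have e2 := abs_le.1 (key (T := lam ^ 2 * T0) (t := lam * V i x) (h1 k)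
      (by rw [mul_pow]; have := m5 i; gcongr) (by linarith))
    have e3 := abs_le.1 (key h0 (m3 i k) (by linarith))
    have e4 := abs_le.1 (key (T := lam ^ 2 * T1) (t := lam * pd k (V i) x) h0
      (by rw [mul_pow]; have := m1 i k; gcongr) (by linarith))
    rw [abs_le]
    constructor <;> nlinarith
  have k3 : |pd k (corrector lam φ V H i) x| ≤ 16 * √Y := by
    rw [pd_corrector hφ hV hH]
    refine (abs_add_le _ _).trans ?_
    have := Finset.abs_sum_le_sum_abs (fun j => pd k (pd j φ) x * (pd i (V j) x - pd j (V i) x)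
        + pd j φ x * (pd k (pd i (V j)) x - pd k (pd j (V i)) x)) Finset.univ
    have h3 := Finset.sum_le_sum (s := Finset.univ) fun j _ => k1 j
    simp only [Finset.sum_const, Finset.card_univ, Fintype.card_fin, nsmul_eq_mul] at h3
    push_cast at h3
    linarith
  calc _ = |pd k (corrector lam φ V H i) x| ^ 2 := (sq_abs _).symm
    _ ≤ (16 * √Y) ^ 2 := by gcongr
    _ = 256 * Y := by rw [mul_pow, Real.sq_sqrt pY]; norm_num

end Corrector

section CorrectorBound

open scoped SchwartzMap FourierTransform LineDeriv Laplacian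

theorem resolvent_energy_le {lam : ℝ} (hlam : 0 < lam) {V g : 𝓢(E3, ℝ)}
    (h : ∀ x, lam * V x - lap V x = g x) :
    lam ^ 2 * (∫ x, V x ^ 2) ≤ ∫ x, g x ^ 2 ∧
    2 * lam * (∑ j, ∫ x, pd j V x ^ 2) ≤ ∫ x, g x ^ 2 ∧
    ∑ j, ∑ k, ∫ x, pd k (pd j V) x ^ 2 ≤ ∫ x, g x ^ 2 := by
  have e := resolvent_energy h
  have p0 : 0 ≤ lam ^ 2 * (∫ x, V x ^ 2) :=
    mul_nonneg (sq_nonneg _) (integral_nonneg fun _ => sq_nonneg _)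
  have p1 : 0 ≤ 2 * lam * (∑ j, ∫ x, pd j V x ^ 2) :=
    mul_nonneg (by positivity) (Finset.sum_nonneg fun _ _ => integral_nonneg fun _ => sq_nonneg _)
  have p2 : 0 ≤ ∑ j, ∑ k, ∫ x, pd k (pd j V) x ^ 2 :=
    Finset.sum_nonneg fun _ _ => Finset.sum_nonneg fun _ _ => integral_nonneg fun _ => sq_nonneg _
  refine ⟨?_, ?_, ?_⟩ <;> linarith

theorem integrable_sq_pd (V : 𝓢(E3, ℝ)) (j : Fin 3) : Integrable (fun x => pd j V x ^ 2) := by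
  have := (schwartzPd j V).integrable_sq
  rwa [coe_schwartzPd] at this

theorem integrable_sq_pd_pd (V : 𝓢(E3, ℝ)) (j k : Fin 3) :
    Integrable (fun x => pd k (pd j V) x ^ 2) := by
  have := integrable_sq_pd (schwartzPd j V) k
  rwa [coe_schwartzPd] at this

theorem integral_sq_pd_corrector_le {lam a b : ℝ} (hlam : 0 < lam) {φ : E3 → ℝ}
    {V g : Fin 3 → 𝓢(E3, ℝ)} {H f : 𝓢(E3, ℝ)}
    (hφ : ContDiff ℝ (⊤ : ℕ∞) φ) (h0 : ∀ x, |φ x| ≤ 1)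
    (h1 : ∀ j x, |pd j φ x| ≤ a) (h2 : ∀ j k x, |pd k (pd j φ) x| ≤ b)
    (hV : ∀ i x, lam * V i x - lap (V i) x = g i x) (hH : ∀ x, lam * H x - lap H x = f x)
    (i k : Fin 3) :
    ∫ x, pd k (corrector lam φ (fun i => V i) H i) x ^ 2 ≤ 256 *
      ((b ^ 2 / (2 * lam) + 2 * a ^ 2 + lam / 2) * (∑ i, ∫ x, g i x ^ 2)
        + (1 + a ^ 2 / (2 * lam)) * ∫ x, f x ^ 2) := by
  set N := ∑ i, ∫ x, g i x ^ 2 with hN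
  set F := ∫ x, f x ^ 2 with hF
  have iT0 : Integrable (fun x => ∑ i, V i x ^ 2) :=
    integrable_finsetSum _ fun i _ => (V i).integrable_sq
  have iT1 : Integrable (fun x => ∑ i, ∑ j, pd j (V i) x ^ 2) :=
    integrable_finsetSum _ fun i _ => integrable_finsetSum _ fun j _ => integrable_sq_pd (V i) j
  have iT2 : Integrable (fun x => ∑ i, ∑ j, ∑ k, pd k (pd j (V i)) x ^ 2) :=
    integrable_finsetSum _ fun i _ => integrable_finsetSum _ fun j _ =>
      integrable_finsetSum _ fun k _ => integrable_sq_pd_pd (V i) j k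
  have iH1 : Integrable (fun x => ∑ j, pd j H x ^ 2) :=
    integrable_finsetSum _ fun j _ => integrable_sq_pd H j
  have iH2 : Integrable (fun x => ∑ j, ∑ k, pd k (pd j H) x ^ 2) :=
    integrable_finsetSum _ fun j _ => integrable_finsetSum _ fun k _ => integrable_sq_pd_pd H j k
  have eT0 : lam ^ 2 * ∫ x, ∑ i, V i x ^ 2 ≤ N := by
    rw [integral_finsetSum _ fun i _ => (V i).integrable_sq, Finset.mul_sum]
    exact Finset.sum_le_sum fun i _ => (resolvent_energy_le hlam (hV i)).1
  have eT1 : 2 * lam * ∫ x, ∑ i, ∑ j, pd j (V i) x ^ 2 ≤ N := by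
    rw [integral_finsetSum _ fun i _ => integrable_finsetSum _ fun j _ => integrable_sq_pd (V i) j,
      Finset.mul_sum]
    refine Finset.sum_le_sum fun i _ => ?_
    rw [integral_finsetSum _ fun j _ => integrable_sq_pd (V i) j]
    exact (resolvent_energy_le hlam (hV i)).2.1
  have eT2 : ∫ x, ∑ i, ∑ j, ∑ k, pd k (pd j (V i)) x ^ 2 ≤ N := by
    rw [integral_finsetSum _ fun i _ => integrable_finsetSum _ fun j _ =>
      integrable_finsetSum _ fun k _ => integrable_sq_pd_pd (V i) j k]
    refine Finset.sum_le_sum fun i _ => ?_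
    rw [integral_finsetSum _ fun j _ => integrable_finsetSum _ fun k _ => integrable_sq_pd_pd (V i) j k]
    refine le_trans (le_of_eq (Finset.sum_congr rfl fun j _ => ?_)) (resolvent_energy_le hlam (hV i)).2.2
    exact integral_finsetSum _ fun k _ => integrable_sq_pd_pd (V i) j k
  have eH1 : 2 * lam * ∫ x, ∑ j, pd j H x ^ 2 ≤ F := by
    rw [integral_finsetSum _ fun j _ => integrable_sq_pd H j]
    exact (resolvent_energy_le hlam hH).2.1
  have eH2 : ∫ x, ∑ j, ∑ k, pd k (pd j H) x ^ 2 ≤ F := by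
    rw [integral_finsetSum _ fun j _ => integrable_finsetSum _ fun k _ => integrable_sq_pd_pd H j k]
    refine le_trans (le_of_eq (Finset.sum_congr rfl fun j _ => ?_)) (resolvent_energy_le hlam hH).2.2
    exact integral_finsetSum _ fun k _ => integrable_sq_pd_pd H j k
  have hpt := fun x => sq_pd_corrector_le (lam := lam) hφ (fun i => (V i).contDiff_top) H.contDiff_top
    i k x (h0 x) (fun j => h1 j x) (fun j k => h2 j k x)
  have s1 := iT1.const_mul (b ^ 2)
  have s2 := iT2.const_mul (a ^ 2)
  have s3 := iH1.const_mul (a ^ 2)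
  have s4 := (iT0.const_mul (lam ^ 2)).const_mul (a ^ 2)
  have s5 := iT1.const_mul (lam ^ 2)
  refine (integral_mono_of_nonneg (ae_of_all _ fun x => sq_nonneg _)
    ((((((s1.add s2).add iH2).add s3).add s4).add s5).const_mul 256) (ae_of_all _ hpt)).trans ?_
  rw [integral_const_mul]
  refine mul_le_mul_of_nonneg_left ?_ (by norm_num)
  refine (integral_add (((((s1.add s2).add iH2).add s3).add s4)) s5).trans_le ?_
  refine (congrArg (· + _) (integral_add ((((s1.add s2).add iH2).add s3)) s4)).trans_le ?_
  refine (congrArg (· + _ + _) (integral_add (((s1.add s2).add iH2)) s3)).trans_le ?_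
  refine (congrArg (· + _ + _ + _) (integral_add ((s1.add s2)) iH2)).trans_le ?_
  refine (congrArg (· + _ + _ + _ + _) (integral_add s1 s2)).trans_le ?_
  simp only [integral_const_mul]
  generalize (∫ x, ∑ i, V i x ^ 2) = T0 at *
  generalize (∫ x, ∑ i, ∑ j, pd j (V i) x ^ 2) = T1 at *
  generalize (∫ x, ∑ i, ∑ j, ∑ k, pd k (pd j (V i)) x ^ 2) = T2 at *
  generalize (∫ x, ∑ j, pd j H x ^ 2) = H1 at *
  generalize (∫ x, ∑ j, ∑ k, pd k (pd j H) x ^ 2) = H2 at *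
  have eT1' : T1 ≤ N / (2 * lam) := by rw [le_div_iff₀ (by positivity)]; linarith
  have eH1' : H1 ≤ F / (2 * lam) := by rw [le_div_iff₀ (by positivity)]; linarith
  have r1 : b ^ 2 * T1 ≤ b ^ 2 * (N / (2 * lam)) := by gcongr
  have r2 : a ^ 2 * T2 ≤ a ^ 2 * N := by gcongr
  have r3 : a ^ 2 * H1 ≤ a ^ 2 * (F / (2 * lam)) := by gcongr
  have r4 : a ^ 2 * (lam ^ 2 * T0) ≤ a ^ 2 * N := by gcongr
  have r5 : lam ^ 2 * T1 ≤ lam ^ 2 * (N / (2 * lam)) := by gcongr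
  have r6 : lam ^ 2 * (N / (2 * lam)) = lam / 2 * N := by field_simp
  have r7 : b ^ 2 * (N / (2 * lam)) = b ^ 2 / (2 * lam) * N := by ring
  have r8 : a ^ 2 * (F / (2 * lam)) = a ^ 2 / (2 * lam) * F := by ring
  linarith

theorem exists_corrector : ∃ C : ℝ, 0 ≤ C ∧ ∀ U : Fin 3 → E3 → ℝ,
    (∀ i, ContDiff ℝ (⊤ : ℕ∞) (U i)) → (∀ x, ∑ j, pd j (U j) x = 0) →
    ∀ r d : ℝ, 0 ≤ r → 0 < d → ∃ (φ : E3 → ℝ) (E : Fin 3 → E3 → ℝ),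
      ContDiff ℝ (⊤ : ℕ∞) φ ∧ (∀ x, 0 ≤ φ x) ∧ (∀ x, ‖x‖ ≤ r → φ x = 1) ∧
      tsupport φ ⊆ ball 0 (r + d) ∧ HasCompactSupport φ ∧ (∀ j x, |pd j φ x| ≤ C / d) ∧
      (∀ i, ContDiff ℝ (⊤ : ℕ∞) (E i)) ∧ (∀ i, tsupport (E i) ⊆ tsupport φ) ∧
      (∀ x, ∑ i, pd i (fun y => φ y * U i y + E i y) x = 0) ∧
      ∀ i k, ∫ x, pd k (E i) x ^ 2 ≤ C / d ^ 2 * ∫ x in ball 0 (r + 2 * d), ∑ i, U i x ^ 2 := by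
  obtain ⟨M, hM1, hM⟩ := exists_cutoff
  have hM2 : M ≤ M ^ 4 := le_self_pow₀ hM1 (by norm_num)
  refine ⟨256 * (9 * M ^ 4), by positivity, fun U hU hdiv r d hr hd => ?_⟩
  obtain ⟨φ, hφ, hφ0, hφ1, hφr, hφs, hφc, hφd, hφdd⟩ := hM r (r + d) hr (by linarith)
  obtain ⟨χ, hχ, hχ0, hχ1, hχr, hχs, hχc, hχd, hχdd⟩ := hM (r + d) (r + 2 * d) (by linarith) (by linarith)
  rw [add_sub_cancel_left] at hφd hφdd
  rw [show r + 2 * d - (r + d) = d by ring] at hχd hχdd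
  have hGs : ∀ i, ContDiff ℝ (⊤ : ℕ∞) (fun x => χ x * U i x) := fun i => hχ.mul (hU i)
  have hGc : ∀ i, HasCompactSupport (fun x => χ x * U i x) := fun i => hχc.mul_right
  set g : Fin 3 → 𝓢(E3, ℝ) := fun i => (hGc i).toSchwartzMap (hGs i) with hg
  have hgx : ∀ i, ⇑(g i) = fun x => χ x * U i x := fun i => rfl
  have hlam : 0 < 1 / d ^ 2 := by positivity
  choose V hV using fun i => exists_resolvent hlam (g i)
  set H : 𝓢(E3, ℝ) := ∑ i, schwartzPd i (V i) with hH
  set f : 𝓢(E3, ℝ) := ∑ i, schwartzPd i (g i) with hf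
  have hHx : ⇑H = fun x => ∑ i, pd i (V i) x := by
    funext x; rw [hH, sum_apply]; simp only [coe_schwartzPd]
  have hfx : ∀ x, f x = ∑ i, pd i (g i) x := by
    intro x; rw [hf, sum_apply]; simp only [coe_schwartzPd]
  have hHf : ∀ x, 1 / d ^ 2 * H x - lap H x = f x := by
    intro x; rw [hfx, hHx]; exact resolvent_div hV x
  have hfU : ∀ x, f x = ∑ i, pd i χ x * U i x := by
    intro x
    rw [hfx]
    have : ∀ i, pd i (g i) x = pd i χ x * U i x + χ x * pd i (U i) x := fun i => by
      rw [hgx, pd_mul (hχ.differentiableAt_of_top x) ((hU i).differentiableAt_of_top x)]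
    simp only [this]
    rw [Finset.sum_add_distrib, ← Finset.mul_sum, hdiv, mul_zero, add_zero]
  set N := ∫ x in ball 0 (r + 2 * d), ∑ i, U i x ^ 2 with hN
  have hUc : Continuous (fun x => ∑ i, U i x ^ 2) :=
    continuous_finsetSum _ fun i _ => (hU i).continuous.pow 2
  have hUi : IntegrableOn (fun x => ∑ i, U i x ^ 2) (ball 0 (r + 2 * d)) :=
    (hUc.locallyIntegrable.integrableOn_isCompact (isCompact_closedBall 0 (r + 2 * d))).mono_set
      ball_subset_closedBall
  have hgN : ∑ i, ∫ x, g i x ^ 2 ≤ N := by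
    rw [← integral_finsetSum _ fun i _ => (g i).integrable_sq, hN, ← integral_indicator measurableSet_ball]
    refine integral_mono (integrable_finsetSum _ fun i _ => (g i).integrable_sq)
      (hUi.integrable_indicator measurableSet_ball) fun x => ?_
    by_cases hx : x ∈ ball (0 : E3) (r + 2 * d)
    · rw [Set.indicator_of_mem hx]
      refine Finset.sum_le_sum fun i _ => ?_
      rw [hgx, mul_pow]
      exact mul_le_of_le_one_left (sq_nonneg _) (pow_le_one₀ (hχ0 x) (hχ1 x))
    · have h0 : χ x = 0 := image_eq_zero_of_notMem_tsupport fun h => hx (hχs h)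
      rw [Set.indicator_of_notMem hx]
      simp [hgx, h0]
  have hfN : ∫ x, f x ^ 2 ≤ 3 * (M / d) ^ 2 * N := by
    rw [hN, ← integral_const_mul, ← integral_indicator measurableSet_ball]
    refine integral_mono f.integrable_sq
      (IntegrableOn.integrable_indicator (hUi.const_mul _) measurableSet_ball) fun x => ?_
    by_cases hx : x ∈ ball (0 : E3) (r + 2 * d)
    · rw [Set.indicator_of_mem hx]
      simp only [hfU]
      have hb : ∀ i, (pd i χ x * U i x) ^ 2 ≤ (M / d) ^ 2 * U i x ^ 2 := fun i => by
        rw [mul_pow, ← sq_abs (pd i χ x)]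
        have := hχd i x
        gcongr
      have h3 := sq_sum_le_card_mul_sum_sq (s := Finset.univ) (f := fun i => pd i χ x * U i x)
      simp only [Finset.card_univ, Fintype.card_fin] at h3
      push_cast at h3
      refine h3.trans ?_
      rw [mul_assoc, Finset.mul_sum _ _ ((M / d) ^ 2)]
      exact mul_le_mul_of_nonneg_left (Finset.sum_le_sum fun i _ => hb i) (zero_le_three : (0 : ℝ) ≤ 3)
    · have h0 : ∀ i, pd i χ x = 0 := fun i =>
        image_eq_zero_of_notMem_tsupport fun h => hx (hχs (tsupport_pd_subset _ _ h))
      rw [Set.indicator_of_notMem hx]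
      simp [hfU, h0]
  have hN0 : 0 ≤ N := integral_nonneg fun x => Finset.sum_nonneg fun _ _ => sq_nonneg _
  refine ⟨φ, corrector (1 / d ^ 2) φ (fun i => V i) H, hφ, hφ0, hφr, hφs, hφc, ?_,
    contDiff_corrector hφ (fun i => (V i).contDiff_top) H.contDiff_top,
    tsupport_corrector_subset _ _ _ _, ?_, ?_⟩
  · intro j x
    refine (hφd j x).trans ?_
    gcongr
    nlinarith [hM2]
  · intro x
    rw [hHx]
    have := sum_pd_add_corrector (lam := 1 / d ^ 2) hφ (fun i => (V i).contDiff_top) x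
    rw [← this]
    refine Finset.sum_congr rfl fun i _ => congrArg (fun h => pd i h x) (funext fun y => ?_)
    congr 1
    rw [hV, hgx]
    by_cases hy : ‖y‖ ≤ r + d
    · simp only [hχr y hy]; ring
    · have h0 : φ y = 0 := image_eq_zero_of_notMem_tsupport fun h =>
        hy (mem_ball_zero_iff.1 (hφs h)).le
      simp [h0]
  · intro i k
    refine (integral_sq_pd_corrector_le hlam hφ (fun x => by rw [abs_of_nonneg (hφ0 x)]; exact hφ1 x)
      hφd hφdd hV hHf i k).trans ?_
    have hM4 : M ^ 2 ≤ M ^ 4 := pow_le_pow_right₀ hM1 (by norm_num)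
    have hM5 : 1 ≤ M ^ 4 := one_le_pow₀ hM1
    clear_value N
    have e1 := mul_le_mul_of_nonneg_left hgN
      (show 0 ≤ (M / d ^ 2) ^ 2 / (2 * (1 / d ^ 2)) + 2 * (M / d) ^ 2 + 1 / d ^ 2 / 2 by positivity)
    have e2 := mul_le_mul_of_nonneg_left hfN
      (show 0 ≤ 1 + (M / d) ^ 2 / (2 * (1 / d ^ 2)) by positivity)
    refine (mul_le_mul_of_nonneg_left (add_le_add e1 e2) (by norm_num)).trans ?_
    calc 256 * (((M / d ^ 2) ^ 2 / (2 * (1 / d ^ 2)) + 2 * (M / d) ^ 2 + 1 / d ^ 2 / 2) * N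
        + (1 + (M / d) ^ 2 / (2 * (1 / d ^ 2))) * (3 * (M / d) ^ 2 * N))
        = 256 * ((M ^ 2 / 2 + 2 * M ^ 2 + 1 / 2 + 3 * M ^ 2 + 3 / 2 * M ^ 4) / d ^ 2 * N) := by
          field_simp
          ring
      _ ≤ 256 * ((9 * M ^ 4) / d ^ 2 * N) := by gcongr; linarith
      _ = 256 * (9 * M ^ 4) / d ^ 2 * N := by ring

end CorrectorBound

section Energy

theorem integral_pd_eq_zero {g : E3 → ℝ} (hg : ContDiff ℝ (⊤ : ℕ∞) g) (hgc : HasCompactSupport g)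
    (j : Fin 3) : ∫ x, pd j g x = 0 := by
  have h := integral_mul_pd (f := fun _ => 1) contDiff_const hg hgc j
  have h0 : ∀ x, pd j (fun _ : E3 => (1 : ℝ)) x = 0 := fun x => by simp [pd]
  simpa [h0] using h

/-- The flux whose divergence is the defect in the local energy balance. -/
def energyFlux (U E : Fin 3 → E3 → ℝ) (P φ : E3 → ℝ) (j : Fin 3) (x : E3) : ℝ :=
  (∑ i, ((pd j (U i) x - U i x * U j x) * (φ x * U i x + E i x)
    + 2⁻¹ * ((U i x * U i x) * (φ x * U j x)))) - P x * (φ x * U j x + E j x)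

theorem sum_pd_energyFlux {U E : Fin 3 → E3 → ℝ} {P φ : E3 → ℝ}
    (hU : ∀ i, ContDiff ℝ (⊤ : ℕ∞) (U i)) (hP : ContDiff ℝ (⊤ : ℕ∞) P)
    (hφ : ContDiff ℝ (⊤ : ℕ∞) φ) (hE : ∀ i, ContDiff ℝ (⊤ : ℕ∞) (E i))
    (hns : ∀ x i, -(lap (U i) x) + (∑ j, U j x * pd j (U i) x) + pd i P x = 0)
    (hdiv : ∀ x, ∑ j, pd j (U j) x = 0)
    (hW : ∀ x, ∑ i, pd i (fun y => φ y * U i y + E i y) x = 0) (x : E3) :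
    ∑ j, pd j (energyFlux U E P φ j) x = ∑ i, ∑ j, (φ x * pd j (U i) x ^ 2
      + pd j (U i) x * (pd j φ x * U i x + pd j (E i) x)
      - U i x * U j x * (pd j φ x * U i x + pd j (E i) x)
      + 2⁻¹ * (U i x ^ 2 * (U j x * pd j φ x))) := by
  have dd : ∀ {f : E3 → ℝ}, ContDiff ℝ (⊤ : ℕ∞) f → DifferentiableAt ℝ f x :=
    fun hf => hf.differentiableAt_of_top x
  have cW : ∀ i, ContDiff ℝ (⊤ : ℕ∞) (fun y => φ y * U i y + E i y) := fun i =>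
    (hφ.mul (hU i)).add (hE i)
  have cφU : ∀ i, ContDiff ℝ (⊤ : ℕ∞) (fun y => φ y * U i y) := fun i => hφ.mul (hU i)
  have cUU : ∀ i j, ContDiff ℝ (⊤ : ℕ∞) (fun y => U i y * U j y) := fun i j => (hU i).mul (hU j)
  have cA : ∀ i j, ContDiff ℝ (⊤ : ℕ∞) (fun y => pd j (U i) y - U i y * U j y) := fun i j =>
    (contDiff_pd (hU i) j).sub (cUU i j)
  have cAW : ∀ i j, ContDiff ℝ (⊤ : ℕ∞)
      (fun y => (pd j (U i) y - U i y * U j y) * (φ y * U i y + E i y)) := fun i j =>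
    (cA i j).mul (cW i)
  have cB : ∀ i j, ContDiff ℝ (⊤ : ℕ∞) (fun y => (U i y * U i y) * (φ y * U j y)) := fun i j =>
    (cUU i i).mul (cφU j)
  have cB' : ∀ i j, ContDiff ℝ (⊤ : ℕ∞) (fun y => 2⁻¹ * ((U i y * U i y) * (φ y * U j y))) :=
    fun i j => contDiff_const.mul (cB i j)
  have cS : ∀ i j, ContDiff ℝ (⊤ : ℕ∞)
      (fun y => (pd j (U i) y - U i y * U j y) * (φ y * U i y + E i y)
        + 2⁻¹ * ((U i y * U i y) * (φ y * U j y))) := fun i j => (cAW i j).add (cB' i j)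
  have cT : ∀ j, ContDiff ℝ (⊤ : ℕ∞)
      (fun y => ∑ i, ((pd j (U i) y - U i y * U j y) * (φ y * U i y + E i y)
        + 2⁻¹ * ((U i y * U i y) * (φ y * U j y)))) := fun j => ContDiff.sum fun i _ => cS i j
  have cPW : ∀ j, ContDiff ℝ (⊤ : ℕ∞) (fun y => P y * (φ y * U j y + E j y)) := fun j =>
    hP.mul (cW j)
  have eW : ∀ i j, pd j (fun y => φ y * U i y + E i y) x
      = pd j φ x * U i x + φ x * pd j (U i) x + pd j (E i) x := fun i j => by
    rw [pd_add (dd (cφU i)) (dd (hE i)), pd_mul (dd hφ) (dd (hU i))]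
  have eF : ∀ j, pd j (energyFlux U E P φ j) x =
      (∑ i, ((pd j (pd j (U i)) x - (pd j (U i) x * U j x + U i x * pd j (U j) x))
          * (φ x * U i x + E i x)
        + (pd j (U i) x - U i x * U j x) * (pd j φ x * U i x + φ x * pd j (U i) x + pd j (E i) x)
        + 2⁻¹ * ((pd j (U i) x * U i x + U i x * pd j (U i) x) * (φ x * U j x)
          + (U i x * U i x) * (pd j φ x * U j x + φ x * pd j (U j) x))))
      - (pd j P x * (φ x * U j x + E j x) + P x * pd j (fun y => φ y * U j y + E j y) x) := by
    intro j
    unfold energyFlux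
    rw [pd_sub (dd (cT j)) (dd (cPW j)), pd_sum fun i _ => dd (cS i j), pd_mul (dd hP) (dd (cW j))]
    congr 1
    refine Finset.sum_congr rfl fun i _ => ?_
    rw [pd_add (dd (cAW i j)) (dd (cB' i j)), pd_mul (dd (cA i j)) (dd (cW i)), eW,
      pd_sub (dd (contDiff_pd (hU i) j)) (dd (cUU i j)), pd_mul (dd (hU i)) (dd (hU j)),
      pd_const_mul _ (dd (cB i j)), pd_mul (dd (cUU i i)) (dd (cφU j)),
      pd_mul (dd (hU i)) (dd (hU i)), pd_mul (dd hφ) (dd (hU j))]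
  have hW' := hW x
  have hd := hdiv x
  have n := hns x
  simp only [eF, lap] at n ⊢
  have n0 := n 0
  have n1 := n 1
  have n2 := n 2
  simp only [Fin.sum_univ_three] at n0 n1 n2 hd hW' ⊢
  linear_combination -(φ x * U 0 x + E 0 x) * n0 - (φ x * U 1 x + E 1 x) * n1
    - (φ x * U 2 x + E 2 x) * n2 - P x * hW'
    - (U 0 x * (φ x * U 0 x + E 0 x) + U 1 x * (φ x * U 1 x + E 1 x) + U 2 x * (φ x * U 2 x + E 2 x)
      - 2⁻¹ * φ x * (U 0 x ^ 2 + U 1 x ^ 2 + U 2 x ^ 2)) * hd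

end Energy

section EnergyInequality

theorem contDiff_energyFlux {U E : Fin 3 → E3 → ℝ} {P φ : E3 → ℝ}
    (hU : ∀ i, ContDiff ℝ (⊤ : ℕ∞) (U i)) (hP : ContDiff ℝ (⊤ : ℕ∞) P)
    (hφ : ContDiff ℝ (⊤ : ℕ∞) φ) (hE : ∀ i, ContDiff ℝ (⊤ : ℕ∞) (E i)) (j : Fin 3) :
    ContDiff ℝ (⊤ : ℕ∞) (energyFlux U E P φ j) :=
  (ContDiff.sum fun i _ => (((contDiff_pd (hU i) j).sub ((hU i).mul (hU j))).mul
    ((hφ.mul (hU i)).add (hE i))).add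
      (contDiff_const.mul (((hU i).mul (hU i)).mul (hφ.mul (hU j))))).sub
    (hP.mul ((hφ.mul (hU j)).add (hE j)))

theorem tsupport_energyFlux_subset {U E : Fin 3 → E3 → ℝ} {P φ : E3 → ℝ}
    (hE : ∀ i, tsupport (E i) ⊆ tsupport φ) (j : Fin 3) :
    tsupport (energyFlux U E P φ j) ⊆ tsupport φ := by
  refine closure_minimal (fun x hx => ?_) (isClosed_tsupport φ)
  by_contra hc
  refine hx ?_
  have h0 : φ x = 0 := image_eq_zero_of_notMem_tsupport hc
  have h1 : ∀ j, E j x = 0 := fun j => image_eq_zero_of_notMem_tsupport fun h => hc (hE j h)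
  simp [energyFlux, h0, h1]

theorem integral_sum_pd_energyFlux {U E : Fin 3 → E3 → ℝ} {P φ : E3 → ℝ}
    (hU : ∀ i, ContDiff ℝ (⊤ : ℕ∞) (U i)) (hP : ContDiff ℝ (⊤ : ℕ∞) P)
    (hφ : ContDiff ℝ (⊤ : ℕ∞) φ) (hφc : HasCompactSupport φ) (hE : ∀ i, ContDiff ℝ (⊤ : ℕ∞) (E i))
    (hEs : ∀ i, tsupport (E i) ⊆ tsupport φ) :
    Integrable (fun x => ∑ j, pd j (energyFlux U E P φ j) x) ∧
      ∫ x, ∑ j, pd j (energyFlux U E P φ j) x = 0 := by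
  have hs := contDiff_energyFlux hU hP hφ hE
  have hc : ∀ j, HasCompactSupport (energyFlux U E P φ j) := fun j =>
    hφc.mono' ((subset_tsupport _).trans (tsupport_energyFlux_subset hEs j))
  have hi : ∀ j, Integrable (pd j (energyFlux U E P φ j)) := fun j =>
    (contDiff_pd (hs j) j).continuous.integrable_of_hasCompactSupport ((hc j).pd j)
  refine ⟨integrable_finsetSum _ fun j _ => hi j, ?_⟩
  rw [integral_finsetSum _ fun j _ => hi j]
  exact Finset.sum_eq_zero fun j _ => integral_pd_eq_zero (hs j) (hc j) j

theorem energy_term_bound {ε a g u v p e : ℝ} (hε : 0 < ε) (hp : |p| ≤ a) :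
    -(g * (p * u + e)) + u * v * (p * u + e) - 2⁻¹ * (u ^ 2 * (v * p)) ≤
      ε * g ^ 2 + ε * (3 / 2 * u ^ 4 + v ^ 4 / 2)
        + ε⁻¹ * (a ^ 2 * u ^ 2 + a ^ 2 * v ^ 2 / 3 + e ^ 2) := by
  have hpa : p ^ 2 ≤ a ^ 2 := by rw [← sq_abs]; gcongr
  set D := p * u + e with hD
  have hi : ε * ε⁻¹ = 1 := mul_inv_cancel₀ hε.ne'
  have hi0 : 0 < ε⁻¹ := inv_pos.2 hε
  have y : ∀ s t : ℝ, s * t ≤ ε * s ^ 2 + ε⁻¹ * t ^ 2 / 4 := by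
    intro s t
    have h : 0 ≤ ε * (s - ε⁻¹ * t / 2) ^ 2 := by positivity
    have e1 : ε * (s - ε⁻¹ * t / 2) ^ 2 = ε * s ^ 2 + (ε * ε⁻¹) * (ε⁻¹ * t ^ 2 / 4) - (ε * ε⁻¹) * (s * t) := by
      ring
    rw [e1, hi] at h
    linarith
  have h1 := y (-g) D
  have h2 := y (u * v) D
  have h3 := y (u ^ 2) (-(2⁻¹ * (v * p)))
  have h4 : D ^ 2 ≤ 2 * (a ^ 2 * u ^ 2) + 2 * e ^ 2 := by
    have : p ^ 2 * u ^ 2 ≤ a ^ 2 * u ^ 2 := by gcongr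
    nlinarith [sq_nonneg (p * u - e)]
  have h5 : (-(2⁻¹ * (v * p))) ^ 2 ≤ a ^ 2 * v ^ 2 / 4 := by
    have : p ^ 2 * v ^ 2 ≤ a ^ 2 * v ^ 2 := by gcongr
    nlinarith
  have h6 : (u * v) ^ 2 ≤ u ^ 4 / 2 + v ^ 4 / 2 := by nlinarith [sq_nonneg (u ^ 2 - v ^ 2)]
  have h7 := mul_le_mul_of_nonneg_left h4 hi0.le
  have h8 := mul_le_mul_of_nonneg_left h5 hi0.le
  have h9 := mul_le_mul_of_nonneg_left h6 hε.le
  have h10 : 0 ≤ ε⁻¹ * (a ^ 2 * v ^ 2) := by positivity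
  nlinarith

theorem exists_energy_inequality : ∃ C : ℝ, 0 ≤ C ∧ ∀ (U : Fin 3 → E3 → ℝ) (P : E3 → ℝ),
    (∀ i, ContDiff ℝ (⊤ : ℕ∞) (U i)) → ContDiff ℝ (⊤ : ℕ∞) P →
    (∀ x i, -(lap (U i) x) + (∑ j, U j x * pd j (U i) x) + pd i P x = 0) →
    (∀ x, ∑ j, pd j (U j) x = 0) → ∀ r d ε : ℝ, 0 ≤ r → 0 < d → 0 < ε →
    ∫ x in ball 0 r, ∑ i, ∑ j, pd j (U i) x ^ 2 ≤
      ε * (∫ x in ball 0 (r + d), ∑ i, ∑ j, pd j (U i) x ^ 2)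
      + 6 * ε * (∫ x in ball 0 (r + d), ∑ i, U i x ^ 4)
      + C / (ε * d ^ 2) * ∫ x in ball 0 (r + 2 * d), ∑ i, U i x ^ 2 := by
  obtain ⟨M, hM0, hM⟩ := exists_corrector
  refine ⟨4 * M ^ 2 + 9 * M, by positivity, fun U P hU hP hns hdiv r d ε hr hd hε => ?_⟩
  obtain ⟨φ, E, hφ, hφ0, hφr, hφs, hφc, hφd, hE, hEs, hW, hEb⟩ := hM U hU hdiv r d hr hd
  obtain ⟨hQi, hQ⟩ := integral_sum_pd_energyFlux hU hP hφ hφc hE hEs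
  have hQe := sum_pd_energyFlux hU hP hφ hE hns hdiv hW
  set Q := fun x => ∑ j, pd j (energyFlux U E P φ j) x with hQdef
  set G := fun x => ∑ i, ∑ j, pd j (U i) x ^ 2 with hG
  set S := fun x => ∑ i, U i x ^ 2 with hS
  set F := fun x => ∑ i, U i x ^ 4 with hF
  set a := M / d with ha
  have hGc : Continuous G := continuous_finsetSum _ fun i _ => continuous_finsetSum _ fun j _ =>
    (contDiff_pd (hU i) j).continuous.pow 2
  have hSc : Continuous S := continuous_finsetSum _ fun i _ => (hU i).continuous.pow 2
  have hFc : Continuous F := continuous_finsetSum _ fun i _ => (hU i).continuous.pow 4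
  have hGn : ∀ x, 0 ≤ G x := fun x => Finset.sum_nonneg fun _ _ => Finset.sum_nonneg fun _ _ => sq_nonneg _
  have hSn : ∀ x, 0 ≤ S x := fun x => Finset.sum_nonneg fun _ _ => sq_nonneg _
  have hEi : ∀ i j, Integrable (fun x => pd j (E i) x ^ 2) := fun i j => by
    refine ((contDiff_pd (hE i) j).continuous.pow 2).integrable_of_hasCompactSupport ?_
    have : HasCompactSupport (pd j (E i)) :=
      HasCompactSupport.pd (hφc.mono' ((subset_tsupport _).trans (hEs i))) j
    simpa only [pow_two] using this.mul_right
  have hbi : ∀ {f : E3 → ℝ}, Continuous f → ∀ ρ, IntegrableOn f (ball 0 ρ) := fun hf ρ =>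
    hf.integrableOn_ball 0 ρ
  have hbd : ∀ x, (ball (0 : E3) r).indicator G x ≤ Q x
      + (ball (0 : E3) (r + d)).indicator (fun x => ε * G x + 6 * ε * F x + 4 * a ^ 2 / ε * S x) x
      + ε⁻¹ * ∑ i, ∑ j, pd j (E i) x ^ 2 := by
    intro x
    have h1 : (ball (0 : E3) r).indicator G x ≤ φ x * G x := by
      by_cases hx : x ∈ ball (0 : E3) r
      · rw [Set.indicator_of_mem hx, hφr x (mem_ball_zero_iff.1 hx).le, one_mul]
      · rw [Set.indicator_of_notMem hx]; exact mul_nonneg (hφ0 x) (hGn x)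
    refine h1.trans ?_
    have hQx : Q x = _ := hQe x
    by_cases hx : x ∈ ball (0 : E3) (r + d)
    · rw [Set.indicator_of_mem hx, hQx]
      have ht := Finset.sum_le_sum (s := Finset.univ) fun (i : Fin 3) _ =>
        Finset.sum_le_sum (s := Finset.univ) fun (j : Fin 3) _ =>
          energy_term_bound (g := pd j (U i) x) (u := U i x) (v := U j x) (e := pd j (E i) x) hε (hφd j x)
      rw [show 4 * a ^ 2 / ε = ε⁻¹ * (4 * a ^ 2) by ring]
      simp only [hG, hF, hS, Fin.sum_univ_three] at ht ⊢
      refine le_of_sub_nonneg ((sub_nonneg.2 ht).trans (le_of_eq ?_))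
      ring
    · have h0 : φ x = 0 := image_eq_zero_of_notMem_tsupport fun h => hx (hφs h)
      have h2 : ∀ j, pd j φ x = 0 := fun j =>
        image_eq_zero_of_notMem_tsupport fun h => hx (hφs (tsupport_pd_subset _ _ h))
      have h3 : ∀ i j, pd j (E i) x = 0 := fun i j =>
        image_eq_zero_of_notMem_tsupport fun h => hx (hφs (hEs i (tsupport_pd_subset _ _ h)))
      rw [Set.indicator_of_notMem hx, hQx]
      simp [h0, h2, h3]
  have iB : IntegrableOn (fun x => ε * G x + 6 * ε * F x + 4 * a ^ 2 / ε * S x) (ball 0 (r + d)) :=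
    hbi (by fun_prop) _
  have iB' := iB.integrable_indicator measurableSet_ball
  have iE : Integrable (fun x => ∑ i, ∑ j, pd j (E i) x ^ 2) :=
    integrable_finsetSum _ fun i _ => integrable_finsetSum _ fun j _ => hEi i j
  have hInt := integral_mono ((hbi hGc r).integrable_indicator measurableSet_ball)
    ((hQi.add iB').add (iE.const_mul ε⁻¹)) hbd
  have e1 : ∫ x, (Q x + (ball (0 : E3) (r + d)).indicator
        (fun x => ε * G x + 6 * ε * F x + 4 * a ^ 2 / ε * S x) x
      + ε⁻¹ * ∑ i, ∑ j, pd j (E i) x ^ 2) = 0 + (ε * (∫ x in ball 0 (r + d), G x)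
        + 6 * ε * (∫ x in ball 0 (r + d), F x) + 4 * a ^ 2 / ε * ∫ x in ball 0 (r + d), S x)
        + ε⁻¹ * ∑ i, ∑ j, ∫ x, pd j (E i) x ^ 2 := by
    rw [← hQ]
    refine (integral_add (hQi.add iB') (iE.const_mul ε⁻¹)).trans ?_
    congr 1
    · refine (integral_add hQi iB').trans ?_
      congr 1
      rw [integral_indicator measurableSet_ball]
      have j1 : IntegrableOn (fun x => ε * G x) (ball 0 (r + d)) := hbi (by fun_prop) _
      have j2 : IntegrableOn (fun x => 6 * ε * F x) (ball 0 (r + d)) := hbi (by fun_prop) _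
      have j3 : IntegrableOn (fun x => 4 * a ^ 2 / ε * S x) (ball 0 (r + d)) := hbi (by fun_prop) _
      refine (integral_add (j1.add j2) j3).trans ?_
      refine (congrArg (· + _) (integral_add j1 j2)).trans ?_
      simp only [integral_const_mul]
    · rw [integral_const_mul, integral_finsetSum _ fun i _ => integrable_finsetSum _ fun j _ => hEi i j]
      congr 1
      exact Finset.sum_congr rfl fun i _ => integral_finsetSum _ fun j _ => hEi i j
  have hInt' := (integral_indicator measurableSet_ball (f := G) (s := ball (0 : E3) r)).symm.trans_le
    (hInt.trans_eq e1)
  have hSS : ∫ x in ball 0 (r + d), S x ≤ ∫ x in ball 0 (r + 2 * d), S x :=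
    setIntegral_mono_set (hbi hSc _) (ae_of_all _ hSn)
      (Eventually.of_forall fun _ hx => ball_subset_ball (by linarith) hx)
  have hEE : ∑ i, ∑ j, ∫ x, pd j (E i) x ^ 2 ≤ 9 * (M / d ^ 2 * ∫ x in ball 0 (r + 2 * d), S x) := by
    have := Finset.sum_le_sum (s := Finset.univ) fun (i : Fin 3) _ =>
      Finset.sum_le_sum (s := Finset.univ) fun (j : Fin 3) _ => hEb i j
    refine this.trans (le_of_eq ?_)
    simp only [Finset.sum_const, Finset.card_univ, Fintype.card_fin, nsmul_eq_mul]
    push_cast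
    ring
  have f1 : 4 * a ^ 2 / ε * (∫ x in ball 0 (r + d), S x)
      ≤ 4 * a ^ 2 / ε * ∫ x in ball 0 (r + 2 * d), S x := by gcongr
  have f2 := mul_le_mul_of_nonneg_left hEE (inv_pos.2 hε).le
  have f3 : (4 * M ^ 2 + 9 * M) / (ε * d ^ 2) * (∫ x in ball 0 (r + 2 * d), S x)
      = 4 * a ^ 2 / ε * (∫ x in ball 0 (r + 2 * d), S x)
        + ε⁻¹ * (9 * (M / d ^ 2 * ∫ x in ball 0 (r + 2 * d), S x)) := by
    rw [ha]; field_simp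
  rw [f3]
  linarith

end EnergyInequality

section Conclusion

theorem le_of_absorbing_iteration {X : ℝ → ℝ} {R A : ℝ} (hR : 0 < R) (hX0 : ∀ r, 0 ≤ X r)
    (hXm : Monotone X)
    (h : ∀ r ρ, R ≤ r → r < ρ → ρ ≤ 2 * R → X r ≤ 2⁻¹ ^ 9 * X ρ + A / (ρ - r) ^ 8) :
    R ^ 8 * X R ≤ 2 ^ 9 * A := by
  set B := R ^ 8 * X (2 * R) with hB
  have claim : ∀ n : ℕ, ∀ r, R ≤ r → r < 2 * R →
      (2 * R - r) ^ 8 * X r ≤ 2⁻¹ ^ n * B + 2 ^ 9 * A * (1 - 2⁻¹ ^ n) := by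
    intro n
    induction n with
    | zero =>
      intro r hr hr2
      have h1 : (2 * R - r) ^ 8 ≤ R ^ 8 := pow_le_pow_left₀ (by linarith) (by linarith) 8
      have h2 := mul_le_mul h1 (hXm hr2.le) (hX0 _) (by positivity)
      simpa using h2
    | succ n ih =>
      intro r hr hr2
      have h1 := h r ((r + 2 * R) / 2) hr (by linarith) (by linarith)
      have h2 := ih ((r + 2 * R) / 2) (by linarith) (by linarith)
      have hs : 0 < 2 * R - r := by linarith
      rw [show 2 * R - (r + 2 * R) / 2 = (2 * R - r) / 2 by ring, div_pow] at h2
      rw [show (r + 2 * R) / 2 - r = (2 * R - r) / 2 by ring, div_pow] at h1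
      have h3 := mul_le_mul_of_nonneg_left h1 (pow_pos hs 8).le
      have h4 : (2 * R - r) ^ 8 * (A / ((2 * R - r) ^ 8 / 2 ^ 8)) = 2 ^ 8 * A := by
        field_simp
      rw [mul_add, h4] at h3
      have h5 : (2⁻¹ : ℝ) ^ (n + 1) = 2⁻¹ ^ n / 2 := by rw [pow_succ]; ring
      rw [h5]
      nlinarith
  have hlim : Tendsto (fun n : ℕ => (2⁻¹ : ℝ) ^ n * B + 2 ^ 9 * A * (1 - 2⁻¹ ^ n)) atTop
      (nhds (0 * B + 2 ^ 9 * A * (1 - 0))) := by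
    have h0 : Tendsto (fun n : ℕ => (2⁻¹ : ℝ) ^ n) atTop (nhds 0) :=
      tendsto_pow_atTop_nhds_zero_of_lt_one (by norm_num) (by norm_num)
    exact (h0.mul_const B).add ((h0.const_sub 1).const_mul (2 ^ 9 * A))
  have h6 := ge_of_tendsto' hlim fun n => claim n R le_rfl (by linarith)
  rw [show 2 * R - R = R by ring] at h6
  linarith

theorem rpow_le_rpow_add_mul {f T q p : ℝ} (hf : 0 ≤ f) (hT : 0 < T) (hq : 0 ≤ q) (hqp : q ≤ p) :
    f ^ q ≤ T ^ q + T ^ (q - p) * f ^ p := by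
  have hT1 : 0 ≤ T ^ q := (rpow_pos_of_pos hT _).le
  have hT2 : 0 ≤ T ^ (q - p) * f ^ p := mul_nonneg (rpow_pos_of_pos hT _).le (rpow_nonneg hf _)
  rcases le_total f T with h | h
  · have := rpow_le_rpow hf h hq
    linarith
  · have hf0 : 0 < f := hT.trans_le h
    have h1 : f ^ q = f ^ (q - p) * f ^ p := by rw [← rpow_add hf0]; congr 1; ring
    have h2 : f ^ (q - p) ≤ T ^ (q - p) := rpow_le_rpow_of_nonpos hT h (by linarith)
    have h3 : f ^ (q - p) * f ^ p ≤ T ^ (q - p) * f ^ p := by gcongr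
    linarith

theorem MemMorrey.exists_setIntegral_rpow_le {f : E3 → ℝ} {p γ q : ℝ} (hf : MemMorrey p γ f)
    (hfc : Continuous f) (hf0 : ∀ x, 0 ≤ f x) (hγ : γ = 3 - 2 / 3 * p) (hq : 0 ≤ q) (hqp : q ≤ p) :
    ∃ K : ℝ, 0 ≤ K ∧ ∀ R : ℝ, 1 ≤ R → ∫ x in ball (0 : E3) R, f x ^ q ≤ K * R ^ (3 - 2 / 3 * q) := by
  obtain ⟨-, C, hC⟩ := hf
  have hC0 : 0 ≤ C := le_trans (mul_nonneg (by positivity)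
    (integral_nonneg fun x => rpow_nonneg (abs_nonneg _) _)) (hC 1 le_rfl)
  set c := volume.real (ball (0 : E3) 1) with hc
  refine ⟨c + C, by positivity, fun R hR => ?_⟩
  have hR0 : 0 < R := by linarith
  set T := R ^ (-(2 / 3) : ℝ) with hT
  have hT0 : 0 < T := rpow_pos_of_pos hR0 _
  have hvol : volume.real (ball (0 : E3) R) = R ^ (3 : ℝ) * c := by
    have := Measure.addHaar_ball_of_pos (volume : Measure E3) 0 hR0
    rw [measureReal_def, this, finrank_euclideanSpace_fin, ENNReal.toReal_mul,
      ENNReal.toReal_ofReal (by positivity), hc, measureReal_def]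
    norm_cast
  have hiq : ∀ {s : ℝ}, 0 ≤ s → IntegrableOn (fun x => f x ^ s) (ball (0 : E3) R) := fun hs =>
    (hfc.rpow_const fun _ => Or.inr hs).integrableOn_ball 0 R
  have hp : 0 ≤ p := hq.trans hqp
  have hFp : ∫ x in ball (0 : E3) R, f x ^ p ≤ C * R ^ γ := by
    have := hC R hR
    simp only [abs_of_nonneg (hf0 _)] at this
    rw [rpow_neg hR0.le, inv_mul_le_iff₀ (rpow_pos_of_pos hR0 _)] at this
    linarith
  calc ∫ x in ball (0 : E3) R, f x ^ q
      ≤ ∫ x in ball (0 : E3) R, (T ^ q + T ^ (q - p) * f x ^ p) :=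
        setIntegral_mono (hiq hq)
          ((continuous_const.integrableOn_ball 0 R).add ((hiq hp).const_mul _))
          fun x => rpow_le_rpow_add_mul (hf0 x) hT0 hq hqp
    _ = R ^ (3 : ℝ) * c * T ^ q + T ^ (q - p) * ∫ x in ball (0 : E3) R, f x ^ p := by
        rw [integral_add (continuous_const.integrableOn_ball 0 R) ((hiq hp).const_mul _),
          integral_const_mul, setIntegral_const, hvol, smul_eq_mul]
    _ ≤ R ^ (3 : ℝ) * c * T ^ q + T ^ (q - p) * (C * R ^ γ) := by gcongr
    _ = c * (R ^ (3 : ℝ) * T ^ q) + C * (T ^ (q - p) * R ^ γ) := by ring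
    _ = (c + C) * R ^ (3 - 2 / 3 * q) := by
        rw [hT, ← rpow_mul hR0.le, ← rpow_mul hR0.le, ← rpow_add hR0, ← rpow_add hR0, hγ, add_mul]
        congr 3 <;> ring

end Conclusion

section Vanishing

theorem pd_eq_zero_of_growth {U : Fin 3 → E3 → ℝ} {P : E3 → ℝ}
    (hU : ∀ i, ContDiff ℝ (⊤ : ℕ∞) (U i)) (hP : ContDiff ℝ (⊤ : ℕ∞) P)
    (hns : ∀ x i, -(lap (U i) x) + (∑ j, U j x * pd j (U i) x) + pd i P x = 0)
    (hdiv : ∀ x, ∑ j, pd j (U j) x = 0) {c K : ℝ} (hc : 0 ≤ c) (hK : 0 ≤ K)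
    (h4 : ∀ i, ∀ R d ρ : ℝ, 1 ≤ R → 0 < d → d ≤ R → ρ ≤ 2 * R → ∫ x in ball 0 ρ, U i x ^ 4 ≤
      c * ((∫ x in ball 0 (ρ + d), ∑ k, pd k (U i) x ^ 2) + R ^ ((23 : ℝ) / 3) / d ^ 8))
    (h2 : ∀ R : ℝ, 1 ≤ R → ∫ x in ball 0 R, ∑ i, U i x ^ 2 ≤ K * R ^ ((5 : ℝ) / 3))
    (i j : Fin 3) (x : E3) : pd j (U i) x = 0 := by
  obtain ⟨C, hC0, hC⟩ := exists_energy_inequality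
  have hen := hC U P hU hP hns hdiv
  set G := fun x => ∑ i, ∑ j, pd j (U i) x ^ 2 with hG
  have hGc : Continuous G := continuous_finsetSum _ fun i _ => continuous_finsetSum _ fun j _ =>
    (contDiff_pd (hU i) j).continuous.pow 2
  have hGn : ∀ x, 0 ≤ G x := fun x => Finset.sum_nonneg fun _ _ => Finset.sum_nonneg fun _ _ => sq_nonneg _
  set X : ℝ → ℝ := fun r => ∫ x in ball 0 r, G x with hX
  have hX0 : ∀ r, 0 ≤ X r := fun r => integral_nonneg hGn
  have hXm : Monotone X := fun r s hrs => setIntegral_mono_set (hGc.integrableOn_ball 0 s)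
    (ae_of_all _ hGn) (Eventually.of_forall fun _ hx => ball_subset_ball hrs hx)
  set ε : ℝ := 2⁻¹ ^ 9 / (1 + 6 * c) with hε
  have hε0 : 0 < ε := by positivity
  set A : ℝ := 2 ^ 8 * (18 * ε * c + C / ε * (4 * K)) with hA
  have hA0 : 0 ≤ A := by positivity
  have hstep : ∀ R, 1 ≤ R → ∀ r ρ, R ≤ r → r < ρ → ρ ≤ 2 * R →
      X r ≤ 2⁻¹ ^ 9 * X ρ + A * R ^ ((23 : ℝ) / 3) / (ρ - r) ^ 8 := by
    intro R hR r ρ hr hrρ hρ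
    have hR0 : 0 < R := by linarith
    set d := (ρ - r) / 2 with hd
    have hd0 : 0 < d := by rw [hd]; linarith
    have hdR : d ≤ R := by rw [hd]; linarith
    have e1 : r + 2 * d = ρ := by rw [hd]; ring
    have e2 : r + d + d = ρ := by rw [hd]; ring
    set Z := R ^ ((23 : ℝ) / 3) / d ^ 8 with hZ
    have hZ0 : 0 ≤ Z := by positivity
    have a1 := hen r d ε (by linarith) hd0 hε0
    have a2 : ∫ x in ball 0 (r + d), ∑ i, U i x ^ 4 ≤ c * (X ρ + 3 * Z) := by
      have hi : ∀ i ∈ Finset.univ, IntegrableOn (fun x => U i x ^ 4) (ball 0 (r + d)) := fun i _ =>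
        ((hU i).continuous.pow 4).integrableOn_ball 0 (r + d)
      rw [integral_finsetSum _ hi]
      have hs := Finset.sum_le_sum (s := Finset.univ) fun (i : Fin 3) _ =>
        h4 i R d (r + d) hR hd0 hdR (by linarith)
      refine hs.trans (le_of_eq ?_)
      rw [← Finset.mul_sum, Finset.sum_add_distrib, e2]
      congr 2
      · rw [hX]
        refine (integral_finsetSum _ fun i _ => ?_).symm
        exact (continuous_finsetSum _ fun j _ =>
          (contDiff_pd (hU i) j).continuous.pow 2).integrableOn_ball 0 ρ
      · simp [hZ]
    have a3 : ∫ x in ball 0 (r + 2 * d), ∑ i, U i x ^ 2 ≤ 4 * K * (Z * d ^ 2) := by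
      rw [e1]
      refine (h2 ρ (by linarith)).trans ?_
      have b1 : ρ ^ ((5 : ℝ) / 3) ≤ (2 * R) ^ ((5 : ℝ) / 3) :=
        rpow_le_rpow (by linarith) hρ (by norm_num)
      have b2 : (2 : ℝ) ^ ((5 : ℝ) / 3) ≤ 4 := by
        have := rpow_le_rpow_of_exponent_le (one_le_two : (1 : ℝ) ≤ 2) (show (5 : ℝ) / 3 ≤ 2 by norm_num)
        refine this.trans (le_of_eq ?_)
        norm_num
      have b3 : R ^ ((5 : ℝ) / 3) ≤ Z * d ^ 2 := by
        have q : R ^ ((23 : ℝ) / 3) = R ^ ((5 : ℝ) / 3) * R ^ 6 := by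
          rw [← rpow_natCast R 6, ← rpow_add hR0]; norm_num
        have q2 : Z * d ^ 2 = R ^ ((5 : ℝ) / 3) * (R ^ 6 / d ^ 6) := by
          rw [hZ, q]; field_simp
        rw [q2]
        refine le_mul_of_one_le_right (by positivity) ?_
        rw [one_le_div (by positivity)]
        gcongr
      calc K * ρ ^ ((5 : ℝ) / 3) ≤ K * (2 * R) ^ ((5 : ℝ) / 3) := by gcongr
        _ = K * (2 ^ ((5 : ℝ) / 3) * R ^ ((5 : ℝ) / 3)) := by rw [mul_rpow (by norm_num) hR0.le]
        _ ≤ K * (4 * (Z * d ^ 2)) := by gcongr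
        _ = 4 * K * (Z * d ^ 2) := by ring
    have a4 : X (r + d) ≤ X ρ := hXm (by linarith)
    have a5 : C / (ε * d ^ 2) * (∫ x in ball 0 (r + 2 * d), ∑ i, U i x ^ 2) ≤ C / ε * (4 * K) * Z := by
      calc _ ≤ C / (ε * d ^ 2) * (4 * K * (Z * d ^ 2)) :=
            mul_le_mul_of_nonneg_left a3 (by positivity)
        _ = C / ε * (4 * K) * Z := by field_simp
    have a6 : 6 * ε * (∫ x in ball 0 (r + d), ∑ i, U i x ^ 4) ≤ 6 * ε * (c * (X ρ + 3 * Z)) := by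
      gcongr
    have a7 : ε * X (r + d) ≤ ε * X ρ := by gcongr
    have a8 : ε * X ρ + 6 * ε * (c * X ρ) = 2⁻¹ ^ 9 * X ρ := by
      rw [hε]; field_simp
    have a9 : A * R ^ ((23 : ℝ) / 3) / (ρ - r) ^ 8 = (18 * ε * c + C / ε * (4 * K)) * Z := by
      rw [hA, hZ, hd]
      have : (ρ - r) ≠ 0 := by linarith
      field_simp
    rw [a9, ← a8]
    have a1' : X r ≤ ε * X (r + d) + 6 * ε * (∫ x in ball 0 (r + d), ∑ i, U i x ^ 4)
      + C / (ε * d ^ 2) * ∫ x in ball 0 (r + 2 * d), ∑ i, U i x ^ 2 := a1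
    linarith
  have hdecay : ∀ R, 1 ≤ R → X R ≤ 2 ^ 9 * A * R ^ (-(1 / 3) : ℝ) := by
    intro R hR
    have hR0 : 0 < R := by linarith
    have h := le_of_absorbing_iteration hR0 hX0 hXm (hstep R hR)
    have q : R ^ ((23 : ℝ) / 3) = R ^ (-(1 / 3) : ℝ) * R ^ 8 := by
      rw [← rpow_natCast R 8, ← rpow_add hR0]; norm_num
    rw [q] at h
    refine le_of_mul_le_mul_left ?_ (pow_pos hR0 8)
    linarith
  have hXz : ∀ r, X r = 0 := by
    intro r
    refine le_antisymm ?_ (hX0 r)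
    have hl : Tendsto (fun R : ℝ => 2 ^ 9 * A * R ^ (-(1 / 3) : ℝ)) atTop (nhds (2 ^ 9 * A * 0)) :=
      (tendsto_rpow_neg_atTop (by norm_num)).const_mul _
    rw [mul_zero] at hl
    refine ge_of_tendsto hl ?_
    filter_upwards [eventually_ge_atTop 1, eventually_ge_atTop r] with R hR hrR
    exact (hXm hrR).trans (hdecay R hR)
  have hGx : G x = 0 := by
    by_contra hne
    have hpos : 0 < G x := lt_of_le_of_ne (hGn x) (Ne.symm hne)
    have hx : x ∈ ball (0 : E3) (‖x‖ + 1) := mem_ball_zero_iff.2 (by linarith)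
    have h0 := hXz (‖x‖ + 1)
    rw [hX] at h0
    have hae := (setIntegral_eq_zero_iff_of_nonneg_ae (ae_of_all _ hGn)
      (hGc.integrableOn_ball 0 (‖x‖ + 1))).1 h0
    have heq := Measure.eqOn_open_of_ae_eq hae isOpen_ball hGc.continuousOn continuousOn_const
    exact hne (heq hx)
  have hle : pd j (U i) x ^ 2 ≤ G x :=
    (Finset.single_le_sum (f := fun j => pd j (U i) x ^ 2) (fun _ _ => sq_nonneg _) (Finset.mem_univ j)).trans
      (Finset.single_le_sum (f := fun i => ∑ j, pd j (U i) x ^ 2)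
        (fun _ _ => Finset.sum_nonneg fun _ _ => sq_nonneg _) (Finset.mem_univ i))
  rw [hGx] at hle
  exact pow_eq_zero_iff (two_ne_zero) |>.1 (le_antisymm hle (sq_nonneg _))

theorem eq_of_pd_eq_zero {f : E3 → ℝ} (hf : ContDiff ℝ (⊤ : ℕ∞) f) (h : ∀ j x, pd j f x = 0)
    (x y : E3) : f x = f y := by
  refine is_const_of_fderiv_eq_zero (𝕜 := ℝ) (hf.differentiable (by simp)) (fun z => ?_) x y
  refine ContinuousLinearMap.coe_injective
    ((EuclideanSpace.basisFun (Fin 3) ℝ).toBasis.ext fun j => ?_)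
  simpa [pd] using h j z

end Vanishing

theorem liouville_stationary_NS_eta_zero_besov
    (u : E3 → Fin 3 → ℝ) (P : E3 → ℝ) (γ p : ℝ)
    (hu : ContDiff ℝ (⊤ : ℕ∞) u) (hP : ContDiff ℝ (⊤ : ℕ∞) P)
    (hsol : StatNS u P)
    (hγ0 : 0 < γ) (hγ3 : γ < 3) (hp3 : 3 ≤ p)
    (hη : γ / p - 3 / p + 2 / 3 = 0)
    (hum : MemMorrey p γ (vecNorm u))
    (hbesov : ∃ C : ℝ, ∀ t : ℝ, 0 < t → ∀ x : E3,
      t ^ ((1 : ℝ) / 2) *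
        Real.sqrt (∑ i, (∫ y : E3, heatKernel t (x - y) * u y i) ^ 2) ≤ C) :
    (∀ x : E3, ∀ i : Fin 3, u x i = 0) ∧ (∃ c : ℝ, ∀ x : E3, P x = c) := by
  have hU : ∀ i, ContDiff ℝ (⊤ : ℕ∞) (fun y => u y i) := contDiff_pi.1 hu
  have hγ : γ = 3 - 2 / 3 * p := by
    have : p ≠ 0 := by positivity
    field_simp at hη
    linarith
  have hvc : Continuous (vecNorm u) := by
    unfold vecNorm
    exact (continuous_finsetSum _ fun i _ => (hU i).continuous.pow 2).sqrt
  have hv0 : ∀ x, 0 ≤ vecNorm u x := fun x => Real.sqrt_nonneg _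
  have hvsq : ∀ x, vecNorm u x ^ 2 = ∑ i, u x i ^ 2 := fun x =>
    Real.sq_sqrt (Finset.sum_nonneg fun _ _ => sq_nonneg _)
  have hle : ∀ i x, |u x i| ≤ vecNorm u x := fun i x => Real.abs_le_sqrt
    (Finset.single_le_sum (f := fun i => u x i ^ 2) (fun _ _ => sq_nonneg _) (Finset.mem_univ i))
  obtain ⟨K1, hK1, h1⟩ := hum.exists_setIntegral_rpow_le hvc hv0 hγ zero_le_one (by linarith)
  obtain ⟨K2, hK2, h2⟩ := hum.exists_setIntegral_rpow_le hvc hv0 hγ zero_le_two (by linarith)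
  obtain ⟨B, hB⟩ := hbesov
  have hheat : ∀ i, ∀ t : ℝ, 0 < t → ∀ x : E3,
      |∫ y, heatKernel t (x - y) * u y i| ≤ (|B| + 1) * t ^ (-(1 : ℝ) / 2) := by
    intro i t ht x
    have ht2 : 0 < t ^ ((1 : ℝ) / 2) := rpow_pos_of_pos ht _
    have a1 : |∫ y, heatKernel t (x - y) * u y i|
        ≤ Real.sqrt (∑ i, (∫ y : E3, heatKernel t (x - y) * u y i) ^ 2) := Real.abs_le_sqrt
      (Finset.single_le_sum (f := fun i => (∫ y : E3, heatKernel t (x - y) * u y i) ^ 2)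
        (fun _ _ => sq_nonneg _) (Finset.mem_univ i))
    have a2 := hB t ht x
    rw [show -(1 : ℝ) / 2 = -(1 / 2) by ring, rpow_neg ht.le, ← div_eq_mul_inv, le_div_iff₀ ht2]
    nlinarith [le_abs_self B]
  have hl1 : ∀ i, ∀ s : ℝ, 1 ≤ s →
      ∫⁻ y in ball (0 : E3) s, ‖u y i‖ₑ ≤ ENNReal.ofReal (K1 * s ^ ((7 : ℝ) / 3)) := by
    intro i s hs
    have hi := (hU i).continuous.integrableOn_ball 0 s
    rw [← ofReal_integral_norm_eq_lintegral_enorm hi]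
    refine ENNReal.ofReal_le_ofReal ?_
    have := h1 s hs
    norm_num at this
    exact (setIntegral_mono hi.norm (hvc.integrableOn_ball 0 s) fun x => hle i x).trans this
  have hs2 : ∀ R : ℝ, 1 ≤ R → ∫ x in ball (0 : E3) R, ∑ i, u x i ^ 2 ≤ K2 * R ^ ((5 : ℝ) / 3) := by
    intro R hR
    have := h2 R hR
    norm_num [hvsq] at this
    exact this
  choose c hc0 hc using fun i => exists_setIntegral_pow_four_le (hU i)
    (show 0 < |B| + 1 by positivity) hK1 (hheat i) (hl1 i)
  have hgrad : ∀ i j x, pd j (fun y => u y i) x = 0 := by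
    refine pd_eq_zero_of_growth hU hP (fun x i => hsol.1 x i) hsol.2
      (c := ∑ i, c i) (Finset.sum_nonneg fun i _ => hc0 i) hK2 (fun i R d ρ hR hd hdR hρ => ?_) hs2
    refine (hc i R d ρ hR hd hdR hρ).trans (mul_le_mul_of_nonneg_right
      (Finset.single_le_sum (fun i _ => hc0 i) (Finset.mem_univ i)) ?_)
    have : 0 ≤ ∫ x in ball (0 : E3) (ρ + d), ∑ k, pd k (fun y => u y i) x ^ 2 :=
      integral_nonneg fun x => Finset.sum_nonneg fun _ _ => sq_nonneg _
    positivity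
  have hconst : ∀ i x, u x i = u 0 i := fun i x => eq_of_pd_eq_zero (hU i) (hgrad i) x 0
  have hzero : ∀ i, u 0 i = 0 := by
    intro i
    set v := volume.real (ball (0 : E3) 1) with hv
    have hvpos : 0 < v := ENNReal.toReal_pos (measure_ball_pos _ _ one_pos).ne' measure_ball_lt_top.ne
    by_contra hne
    have hpos : 0 < |u 0 i| := abs_pos.2 hne
    have hbd : ∀ R : ℝ, 1 ≤ R → |u 0 i| * v ≤ K1 * R ^ (-(2 / 3) : ℝ) := by
      intro R hR
      have hR0 : 0 < R := by linarith
      have hi := (hU i).continuous.integrableOn_ball 0 R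
      have hh := h1 R hR
      norm_num at hh
      have h3 := (setIntegral_mono hi.norm (hvc.integrableOn_ball 0 R) fun x => hle i x).trans hh
      simp only [hconst i, setIntegral_const, smul_eq_mul, Real.norm_eq_abs] at h3
      have hvol : volume.real (ball (0 : E3) R) = R ^ (3 : ℝ) * v := by
        rw [measureReal_def, Measure.addHaar_ball_of_pos (volume : Measure E3) 0 hR0,
          finrank_euclideanSpace_fin, ENNReal.toReal_mul, ENNReal.toReal_ofReal (by positivity), hv,
          measureReal_def]
        norm_cast
      rw [hvol, show (7 : ℝ) / 3 = 3 + -(2 / 3) by norm_num, rpow_add hR0] at h3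
      refine le_of_mul_le_mul_left ?_ (rpow_pos_of_pos hR0 (3 : ℝ))
      linarith
    have hl : Tendsto (fun R : ℝ => K1 * R ^ (-(2 / 3) : ℝ)) atTop (nhds (K1 * 0)) :=
      (tendsto_rpow_neg_atTop (by norm_num)).const_mul _
    rw [mul_zero] at hl
    have := ge_of_tendsto hl ((eventually_ge_atTop 1).mono hbd)
    nlinarith [mul_pos hpos hvpos]
  have hu0 : ∀ x i, u x i = 0 := fun x i => (hconst i x).trans (hzero i)
  refine ⟨hu0, P 0, fun x => eq_of_pd_eq_zero hP (fun i x => ?_) x 0⟩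
  have hn := hsol.1 x i
  have hf : pd i (fun y => u y i) = fun _ => 0 := funext fun y => hgrad i i y
  have hlap : lap (fun y => u y i) x = 0 := by
    refine Finset.sum_eq_zero fun j _ => ?_
    rw [show pd j (fun y => u y i) = fun _ => 0 from funext fun y => hgrad i j y]
    simp [pd]
  simpa [hlap, hgrad] using hn
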